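/- Let m be a natural number, let A be a finite non-empty subset of S_{4,m}, and set δ = 1/1392. Then for every ε > 0 there is a constant C(ε) > 0, independent of m and A, such that E_{2,2}(A) ≤ C(ε) · m^ε · |A|^{2 + 1/3 − δ}. -/

import Mathlib

open Finset

noncomputable section

/-- The set of lattice points on the sphere of radius `√m` in `ℤ^d`. -/
def latSphere (d m : ℕ) : Set (Fin d → ℤ) := {x | ∑ i, x i ^ 2 = (m : ℤ)}

/-- The additive energy `E_{s,2}(A)`: the number of `2s`-tuples
`(x₁, …, x_{2s}) ∈ A^{2s}` with `x₁ + ⋯ + x_s = x_{s+1} + ⋯ + x_{2s}`. -/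
def addEnergy {V : Type*} [AddCommMonoid V] (s : ℕ) (A : Set V) : ℕ :=
  Nat.card {p : (Fin s → V) × (Fin s → V) //
    (∀ i, p.1 i ∈ A) ∧ (∀ i, p.2 i ∈ A) ∧ ∑ i, p.1 i = ∑ i, p.2 i}

/-- The representation function `r_s(A, n)`: the number of `s`-tuples
`(x₁, …, x_s) ∈ A^s` with `x₁ + ⋯ + x_s = n`. -/
def repCount {V : Type*} [AddCommMonoid V] (s : ℕ) (A : Set V) (n : V) : ℕ :=
  Nat.card {x : Fin s → V // (∀ i, x i ∈ A) ∧ ∑ i, x i = n}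

lemma aux_div_small (ε : ℝ) (hε : 0 < ε) : ∃ K : ℝ, 1 ≤ K ∧ ∀ p k : ℕ, 2 ≤ p →
    ((k : ℝ) + 1) ≤ K * ((p : ℝ) ^ k) ^ ε := by
  have hl : 0 < Real.log 2 := Real.log_pos (by norm_num)
  refine ⟨max 1 (1 / (ε * Real.log 2)), le_max_left _ _, fun p k hp => ?_⟩
  set K := max 1 (1 / (ε * Real.log 2))
  have h1 : 1 ≤ K := le_max_left _ _
  have h2 : 1 / (ε * Real.log 2) ≤ K := le_max_right _ _
  have h3 : 1 ≤ K * (ε * Real.log 2) := by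
    rw [div_le_iff₀ (by positivity)] at h2; exact h2
  have hp' : (2:ℝ) ≤ p := by exact_mod_cast hp
  have h4 : (1 + k * (ε * Real.log 2)) ≤ ((p : ℝ) ^ k) ^ ε := by
    have : ((2 : ℝ) ^ k) ^ ε ≤ ((p : ℝ) ^ k) ^ ε := by gcongr
    refine le_trans ?_ this
    rw [Real.rpow_def_of_pos (by positivity), Real.log_pow]
    have := Real.add_one_le_exp (k * Real.log 2 * ε)
    linarith
  have hk : (0:ℝ) ≤ k := by positivity
  calc (k:ℝ) + 1 ≤ K * (1 + k * (ε * Real.log 2)) := by nlinarith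
    _ ≤ _ := by gcongr

lemma divisor_bound (ε : ℝ) (hε : 0 < ε) : ∃ C : ℝ, 1 ≤ C ∧ ∀ n : ℕ, n ≠ 0 →
    (n.divisors.card : ℝ) ≤ C * (n : ℝ) ^ ε := by
  obtain ⟨K, hK, hKp⟩ := aux_div_small ε hε
  obtain ⟨P, hP⟩ := exists_nat_ge ((2:ℝ) ^ (1 / ε))
  refine ⟨K ^ P, one_le_pow₀ hK, fun n hn => ?_⟩
  have hbig : ∀ p k : ℕ, P ≤ p → ((k : ℝ) + 1) ≤ ((p : ℝ) ^ k) ^ ε := by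
    intro p k hp
    have h1 : (2:ℝ) ^ (1/ε) ≤ p := hP.trans (by exact_mod_cast hp)
    have h2 : (2:ℝ) ≤ (p:ℝ) ^ ε := by
      have := Real.rpow_le_rpow (by positivity) h1 hε.le
      rwa [← Real.rpow_mul (by norm_num), one_div_mul_cancel hε.ne', Real.rpow_one] at this
    have h3 : ((p : ℝ) ^ k) ^ ε = ((p:ℝ) ^ ε) ^ k := by
      rw [← Real.rpow_natCast, ← Real.rpow_mul (by positivity), mul_comm, Real.rpow_mul (by positivity), Real.rpow_natCast]
    rw [h3]
    calc (k:ℝ) + 1 ≤ (2:ℝ) ^ k := by exact_mod_cast Nat.lt_two_pow_self (n := k)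
      _ ≤ _ := by gcongr
  rw [Nat.card_divisors hn]
  have hn2 : (n : ℝ) ^ ε = ∏ p ∈ n.primeFactors, ((p : ℝ) ^ (n.factorization p)) ^ ε := by
    rw [Real.finsetProd_rpow _ _ (by intros; positivity)]
    congr 1
    conv_lhs => rw [← Nat.prod_factorization_pow_eq_self hn]
    rw [Nat.prod_factorization_eq_prod_primeFactors]; push_cast; rfl
  have hc : (∏ p ∈ n.primeFactors, (if p < P then K else 1)) ≤ K ^ P := by
    rw [Finset.prod_ite, Finset.prod_const, Finset.prod_const_one, mul_one]
    apply pow_le_pow_right₀ hK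
    calc _ ≤ (Finset.range P).card := by
          apply Finset.card_le_card; intro x; simp
      _ = P := by simp
  calc ((∏ x ∈ n.primeFactors, (n.factorization x + 1) : ℕ) : ℝ)
      = ∏ x ∈ n.primeFactors, ((n.factorization x : ℝ) + 1) := by push_cast; rfl
    _ ≤ ∏ x ∈ n.primeFactors, ((if x < P then K else 1) * ((x : ℝ) ^ (n.factorization x)) ^ ε) := by
        apply Finset.prod_le_prod
        · intros; positivity
        · intro p hp
          have h2 := (Nat.prime_of_mem_primeFactors hp).two_le
          split_ifs with h
          · exact hKp _ _ h2
          · rw [one_mul]; exact hbig _ _ (not_lt.mp h)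
    _ = (∏ x ∈ n.primeFactors, (if x < P then K else 1)) * (n:ℝ) ^ ε := by
        rw [Finset.prod_mul_distrib, hn2]
    _ ≤ _ := by gcongr

lemma bf_fibre (a b : ℤ) (N : ℕ) (ha : 1 ≤ a) (hb : 1 ≤ b) (hN : 1 ≤ N) (F : Finset (ℤ × ℤ))
    (hF : ∀ z ∈ F, a * z.2 ^ 2 + b * z.1 ^ 2 = N) (z1 : ℤ × ℤ) (hz1 : z1 ∈ F)
    (hd : ∀ z ∈ F, (N : ℤ) ∣ 2 * (z1.2 * z.1 - z.2 * z1.1)) : F.card ≤ 10 := by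
  have hN' : (1:ℤ) ≤ N := by exact_mod_cast hN
  set f : ℤ × ℤ → ℤ × Bool := fun z =>
    (2 * (z1.2 * z.1 - z.2 * z1.1) / N, decide (0 ≤ a * z1.2 * z.2 + b * z1.1 * z.1)) with hf
  have key : ∀ z ∈ F, (a * z1.2 * z.2 + b * z1.1 * z.1) ^ 2
      + a * b * (z1.2 * z.1 - z.2 * z1.1) ^ 2 = (N:ℤ) ^ 2 := by
    intro z hz
    have h1 := hF z hz
    have h2 := hF z1 hz1
    rw [sq (N:ℤ)]; nth_rw 1 [← h1]; rw [← h2]; ring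
  have hmap : ∀ z ∈ F, f z ∈ (Finset.Icc (-2:ℤ) 2) ×ˢ (Finset.univ : Finset Bool) := by
    intro z hz
    obtain ⟨k, hk⟩ := hd z hz
    have hq : 2 * (z1.2 * z.1 - z.2 * z1.1) / (N:ℤ) = k := by
      rw [hk]; exact Int.mul_ediv_cancel_left _ (by omega)
    simp only [hf, Finset.mem_product, Finset.mem_univ, and_true, hq, Finset.mem_Icc]
    have h := key z hz
    have h3 : a * b * (k * N) ^ 2 ≤ 4 * (N:ℤ) ^ 2 := by
      have : (k * N) ^ 2 = 4 * (z1.2 * z.1 - z.2 * z1.1) ^ 2 := by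
        rw [mul_comm k, ← hk]; ring
      rw [this]
      nlinarith [sq_nonneg (a * z1.2 * z.2 + b * z1.1 * z.1)]
    have hab : 1 ≤ a * b := by nlinarith
    have h4 : (k * N) ^ 2 ≤ 4 * (N:ℤ) ^ 2 := by
      nlinarith [sq_nonneg (k * (N:ℤ))]
    have h5 : k ^ 2 ≤ 4 := by
      have hNp : 0 < (N:ℤ)^2 := by positivity
      rw [mul_pow] at h4
      exact le_of_mul_le_mul_right h4 hNp
    constructor <;> nlinarith
  have hinj : Set.InjOn f (F : Set (ℤ × ℤ)) := by
    intro z hz w hw hzw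
    simp only [hf, Prod.mk.injEq, decide_eq_decide] at hzw
    obtain ⟨h1, h2⟩ := hzw
    have hz' : z ∈ F := hz
    have hw' : w ∈ F := hw
    have hu : z1.2 * z.1 - z.2 * z1.1 = z1.2 * w.1 - w.2 * z1.1 := by
      have e1 := Int.mul_ediv_cancel' (hd z hz')
      have e2 := Int.mul_ediv_cancel' (hd w hw')
      rw [h1] at e1
      linarith
    have hw2 : (a * z1.2 * z.2 + b * z1.1 * z.1) = a * z1.2 * w.2 + b * z1.1 * w.1 := by
      have k1 := key z hz'
      have k2 := key w hw'
      rw [hu] at k1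
      have : (a * z1.2 * z.2 + b * z1.1 * z.1) ^ 2 = (a * z1.2 * w.2 + b * z1.1 * w.1) ^ 2 := by
        linarith
      rcases sq_eq_sq_iff_eq_or_eq_neg.mp this with h | h
      · exact h
      · by_cases h0 : 0 ≤ a * z1.2 * z.2 + b * z1.1 * z.1
        · have := h2.mp h0; linarith
        · have h0' : ¬ (0 ≤ a * z1.2 * w.2 + b * z1.1 * w.1) := fun hh => h0 (h2.mpr hh)
          push Not at h0 h0'; linarith
    have e := hF z1 hz1
    have ex : (N:ℤ) * z.1 = N * w.1 := by
      rw [← e]; linear_combination z1.1 * hw2 + a * z1.2 * hu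
    have ey : (N:ℤ) * z.2 = N * w.2 := by
      rw [← e]; linear_combination z1.2 * hw2 - b * z1.1 * hu
    have hN0 : (N:ℤ) ≠ 0 := by omega
    exact Prod.ext (mul_left_cancel₀ hN0 ex) (mul_left_cancel₀ hN0 ey)
  calc F.card ≤ ((Finset.Icc (-2:ℤ) 2) ×ˢ (Finset.univ : Finset Bool)).card :=
        Finset.card_le_card_of_injOn f hmap hinj
    _ = 10 := by decide

lemma bf_coprime (a b : ℤ) (N : ℕ) (ha : 1 ≤ a) (hb : 1 ≤ b) (hN : 1 ≤ N) (S : Finset (ℤ × ℤ))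
    (hS : ∀ z ∈ S, a * z.2 ^ 2 + b * z.1 ^ 2 = N ∧ IsCoprime z.1 z.2)
    (hco : IsCoprime (N:ℤ) (a * b)) : S.card ≤ 10 * N.divisors.card ^ 2 := by
  classical
  rcases S.eq_empty_or_nonempty with rfl | ⟨z0, hz0⟩
  · simp
  have hca : IsCoprime (N:ℤ) a := (IsCoprime.mul_right_iff.mp hco).1
  have hcb : IsCoprime (N:ℤ) b := (IsCoprime.mul_right_iff.mp hco).2
  have hX : ∀ z ∈ S, IsCoprime (N:ℤ) z.1 := by
    intro z hz
    obtain ⟨h1, h2⟩ := hS z hz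
    rw [← h1]
    have h3 : IsCoprime a z.1 := by
      -- prime argument
      rw [Int.isCoprime_iff_gcd_eq_one]
      by_contra hne
      obtain ⟨p, hp, hpd⟩ := Nat.exists_prime_and_dvd hne
      have hpa : (p:ℤ) ∣ a := (Int.natCast_dvd_natCast.mpr hpd).trans (Int.gcd_dvd_left ..)
      have hpx : (p:ℤ) ∣ z.1 := (Int.natCast_dvd_natCast.mpr hpd).trans (Int.gcd_dvd_right ..)
      have hpN : (p:ℤ) ∣ N := by
        rw [← h1]; exact dvd_add (hpa.mul_right _) ((dvd_pow hpx two_ne_zero).mul_left _)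
      have := hca.isUnit_of_dvd' hpN hpa
      exact (Nat.prime_iff_prime_int.mp hp).not_isUnit this
    have h4 : IsCoprime (a * z.2 ^ 2) z.1 := h3.mul_left h2.symm.pow_left
    have := IsCoprime.add_mul_right_left h4 (b * z.1)
    have e : a * z.2 ^ 2 + b * z.1 ^ 2 = a * z.2 ^ 2 + b * z.1 * z.1 := by ring
    rw [e]; exact this
  set u : ℤ × ℤ → ℤ := fun z => z.2 * z0.1 - z.1 * z0.2 with hu
  set v : ℤ × ℤ → ℤ := fun z => z.2 * z0.1 + z.1 * z0.2 with hv
  set f : ℤ × ℤ → ℕ × ℕ := fun z => (Int.gcd (u z) N, Int.gcd (v z) N) with hf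
  have hmaps : ∀ z ∈ S, f z ∈ N.divisors ×ˢ N.divisors := by
    intro z _
    simp only [hf, Finset.mem_product, Nat.mem_divisors]
    have hg : ∀ t : ℤ, Int.gcd t N ∣ N := fun t => by
      have := Int.gcd_dvd_right t (N:ℤ); exact_mod_cast this
    exact ⟨⟨hg _, by omega⟩, ⟨hg _, by omega⟩⟩
  have hfib : ∀ y ∈ N.divisors ×ˢ N.divisors, (S.filter (fun z => f z = y)).card ≤ 10 := by
    intro y _
    rcases (S.filter (fun z => f z = y)).eq_empty_or_nonempty with h | ⟨z1, hz1⟩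
    · rw [h]; simp
    apply bf_fibre a b N ha hb hN _ (fun z hz => (hS z (Finset.mem_filter.mp hz).1).1) z1 hz1
    intro z hz
    obtain ⟨hzS, hzy⟩ := Finset.mem_filter.mp hz
    obtain ⟨hz1S, hz1y⟩ := Finset.mem_filter.mp hz1
    set g : ℤ := (y.1 : ℤ) with hg
    set h : ℤ := (y.2 : ℤ) with hh
    have g1 : g ∣ u z1 := by rw [hg, ← hz1y]; exact Int.gcd_dvd_left ..
    have g2 : g ∣ u z := by rw [hg, ← hzy]; exact Int.gcd_dvd_left ..
    have gN : g ∣ N := by rw [hg, ← hzy]; exact Int.gcd_dvd_right ..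
    have h1 : h ∣ v z1 := by rw [hh, ← hz1y]; exact Int.gcd_dvd_left ..
    have h2 : h ∣ v z := by rw [hh, ← hzy]; exact Int.gcd_dvd_left ..
    have hhN : h ∣ N := by rw [hh, ← hzy]; exact Int.gcd_dvd_right ..
    have hNuv : (N:ℤ) ∣ u z * v z := by
      have e1 := (hS z hzS).1
      have e0 := (hS z0 hz0).1
      have : (N:ℤ) ∣ a * (u z * v z) := ⟨z0.1 ^ 2 - z.1 ^ 2, by
        simp only [hu, hv]
        linear_combination z0.1 ^ 2 * e1 - z.1 ^ 2 * e0⟩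
      exact hca.dvd_of_dvd_mul_left this
    have hNgh : (N:ℤ) ∣ g * h := by
      have hgz : g = gcd (u z) (N:ℤ) := by rw [hg, ← hzy]; exact Int.coe_gcd _ _
      have hhz : h = gcd (v z) (N:ℤ) := by rw [hh, ← hzy]; exact Int.coe_gcd _ _
      rw [hgz, hhz]
      have A1 : (N:ℤ) ∣ gcd (u z) N * v z := by
        have : (N:ℤ) ∣ gcd (u z * v z) (N * v z) := dvd_gcd hNuv (dvd_mul_right _ _)
        rw [_root_.gcd_mul_right] at this
        exact this.trans (mul_dvd_mul_left _ (normalize_dvd_iff.mpr dvd_rfl))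
      have : (N:ℤ) ∣ gcd (gcd (u z) (N:ℤ) * v z) (gcd (u z) (N:ℤ) * N) :=
        dvd_gcd A1 (dvd_mul_left _ _)
      rw [_root_.gcd_mul_left] at this
      exact this.trans (mul_dvd_mul_right (normalize_dvd_iff.mpr dvd_rfl) _)
    set w := z1.2 * z.1 - z.2 * z1.1 with hw
    have gw : g ∣ w := by
      have hc : IsCoprime g z0.1 := (hX z0 hz0).of_isCoprime_of_dvd_left gN
      apply hc.dvd_of_dvd_mul_left
      have : z0.1 * w = z.1 * u z1 - z1.1 * u z := by simp only [hu, hw]; ring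
      rw [this]; exact dvd_sub (g1.mul_left _) (g2.mul_left _)
    have hhw : h ∣ w := by
      have hc : IsCoprime h z0.1 := (hX z0 hz0).of_isCoprime_of_dvd_left hhN
      apply hc.dvd_of_dvd_mul_left
      have : z0.1 * w = z.1 * v z1 - z1.1 * v z := by simp only [hv, hw]; ring
      rw [this]; exact dvd_sub (h1.mul_left _) (h2.mul_left _)
    have hgcd2 : gcd g h ∣ 2 := by
      have d1 : gcd g h ∣ u z := (gcd_dvd_left _ _).trans g2
      have d2 : gcd g h ∣ v z := (gcd_dvd_right _ _).trans h2
      have hc : IsCoprime (gcd g h) (z0.1) :=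
        (hX z0 hz0).of_isCoprime_of_dvd_left ((gcd_dvd_left _ _).trans gN)
      have hcz : IsCoprime (gcd g h) (z.1) :=
        (hX z hzS).of_isCoprime_of_dvd_left ((gcd_dvd_left _ _).trans gN)
      -- also divides 2 * z.1 * z0.2 and 2 * z.2 * z0.1
      have d3 : gcd g h ∣ z0.1 * (2 * z.2) := by
        have : z0.1 * (2 * z.2) = u z + v z := by simp only [hu, hv]; ring
        rw [this]; exact dvd_add d1 d2
      have d4 : gcd g h ∣ 2 * z.2 := hc.dvd_of_dvd_mul_left d3
      have d5 : gcd g h ∣ 2 * z.1 * z0.2 := by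
        have : 2 * z.1 * z0.2 = v z - u z := by simp only [hu, hv]; ring
        rw [this]; exact dvd_sub d2 d1
      -- N coprime to z.2 as well
      have hY : IsCoprime (N:ℤ) z.2 := by
        have e1 := (hS z hzS).1
        have hx2 : IsCoprime (N:ℤ) (b * z.1 ^ 2) := hcb.mul_right (hX z hzS).pow_right
        have : IsCoprime (N:ℤ) (a * z.2 ^ 2) := by
          have : a * z.2 ^ 2 = -(b * z.1 ^ 2) + N * 1 := by linarith
          rw [this]
          exact hx2.neg_right.add_mul_left_right 1
        have := (IsCoprime.mul_right_iff.mp this).2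
        exact (IsCoprime.pow_right_iff two_pos).mp this
      have hcy : IsCoprime (gcd g h) z.2 :=
        hY.of_isCoprime_of_dvd_left ((gcd_dvd_left _ _).trans gN)
      exact hcy.dvd_of_dvd_mul_right d4
    have hl : lcm g h ∣ w := lcm_dvd gw hhw
    have : g * h ∣ 2 * w := by
      have h5 : g * h ∣ gcd g h * lcm g h := (gcd_mul_lcm g h).symm.dvd
      exact h5.trans (mul_dvd_mul hgcd2 hl)
    exact hNgh.trans this
  have := Finset.card_le_mul_card_image_of_maps_to hmaps 10 hfib
  rw [Finset.card_product] at this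
  calc S.card ≤ _ := this
    _ = _ := by ring

lemma bf_primitive : ∀ N : ℕ, 1 ≤ N → ∀ a b : ℤ, 1 ≤ a → 1 ≤ b → ∀ S : Finset (ℤ × ℤ),
    (∀ z ∈ S, a * z.2 ^ 2 + b * z.1 ^ 2 = N ∧ IsCoprime z.1 z.2) →
    S.card ≤ 10 * N.divisors.card ^ 2 := by
  classical
  intro N
  induction N using Nat.strong_induction_on with
  | _ N ih =>
  intro hN
  have step : ∀ p : ℕ, p.Prime → p ∣ N → ∀ a b : ℤ, 1 ≤ a → 1 ≤ b → (p:ℤ) ∣ b →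
      ∀ S : Finset (ℤ × ℤ), (∀ z ∈ S, a * z.2 ^ 2 + b * z.1 ^ 2 = N ∧ IsCoprime z.1 z.2) →
      S.card ≤ 10 * N.divisors.card ^ 2 := by
    rintro p hp ⟨N', rfl⟩ a b ha hb ⟨b', rfl⟩ S hS
    have hp2 := hp.two_le
    have hpz : (p:ℤ) ≠ 0 := by exact_mod_cast hp.ne_zero
    have hp0 : (0:ℤ) < p := by exact_mod_cast hp.pos
    have hN' : 1 ≤ N' := by
      rcases Nat.eq_zero_or_pos N' with h | h
      · subst h; simp at hN
      · exact h
    have hlt : N' < p * N' := by nlinarith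
    have hdiv : N'.divisors.card ≤ (p * N').divisors.card :=
      Finset.card_le_card (Nat.divisors_subset_of_dvd (by omega) (dvd_mul_left _ _))
    have hb' : 1 ≤ b' := by
      by_contra h
      push Not at h
      nlinarith
    refine le_trans ?_ (Nat.mul_le_mul_left 10 (Nat.pow_le_pow_left hdiv 2))
    by_cases hpa : (p:ℤ) ∣ a
    · obtain ⟨a', rfl⟩ := hpa
      have ha' : 1 ≤ a' := by
        by_contra h
        push Not at h
        nlinarith
      apply ih N' hlt hN' a' b' ha' hb' S
      intro z hz
      refine ⟨?_, (hS z hz).2⟩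
      have := (hS z hz).1
      push_cast at this
      apply mul_left_cancel₀ hpz
      linarith
    · have hpY : ∀ z ∈ S, (p:ℤ) ∣ z.2 := by
        intro z hz
        have h1 := (hS z hz).1
        push_cast at h1
        have h2 : (p:ℤ) ∣ a * z.2 ^ 2 := ⟨N' - b' * z.1 ^ 2, by linarith⟩
        have hpp := Nat.prime_iff_prime_int.mp hp
        exact hpp.dvd_of_dvd_pow ((hpp.dvd_or_dvd h2).resolve_left hpa)
      set f : ℤ × ℤ → ℤ × ℤ := fun z => (z.1, z.2 / p) with hf
      have hinj : Set.InjOn f (S : Set (ℤ × ℤ)) := by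
        intro z hz w hw h
        simp only [hf, Prod.mk.injEq] at h
        have e1 := Int.mul_ediv_cancel' (hpY z hz)
        have e2 := Int.mul_ediv_cancel' (hpY w hw)
        rw [h.2, e2] at e1
        exact Prod.ext h.1 e1.symm
      rw [← Finset.card_image_of_injOn hinj]
      apply ih N' hlt hN' (p * a) b' (by nlinarith) hb'
      intro y hy
      obtain ⟨z, hz, rfl⟩ := Finset.mem_image.mp hy
      obtain ⟨t, ht⟩ := hpY z hz
      have h1 := hS z hz
      have hq : z.2 / (p:ℤ) = t := by rw [ht]; exact Int.mul_ediv_cancel_left _ hpz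
      simp only [hf, hq]
      rw [ht] at h1
      refine ⟨?_, (IsCoprime.mul_right_iff.mp h1.2).2⟩
      have := h1.1
      push_cast at this
      apply mul_left_cancel₀ hpz
      linarith
  intro a b ha hb S hS
  by_cases hco : IsCoprime (N:ℤ) (a * b)
  · exact bf_coprime a b N ha hb hN S hS hco
  · rw [Int.isCoprime_iff_gcd_eq_one] at hco
    obtain ⟨p, hp, hpd⟩ := Nat.exists_prime_and_dvd hco
    have hpN : (p:ℤ) ∣ N := (Int.natCast_dvd_natCast.mpr hpd).trans (Int.gcd_dvd_left ..)
    have hpab : (p:ℤ) ∣ a * b := (Int.natCast_dvd_natCast.mpr hpd).trans (Int.gcd_dvd_right ..)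
    have hpN' : p ∣ N := by exact_mod_cast hpN
    rcases (Nat.prime_iff_prime_int.mp hp).dvd_or_dvd hpab with h | h
    · have := step p hp hpN' b a hb ha h (S.map (Equiv.prodComm ℤ ℤ).toEmbedding) (by
        intro z hz
        simp only [Finset.mem_map_equiv] at hz
        have := hS _ hz
        simp only [Equiv.prodComm_symm, Equiv.prodComm_apply, Prod.fst_swap, Prod.snd_swap] at this
        exact ⟨by linarith [this.1], this.2.symm⟩)
      rwa [Finset.card_map] at this
    · exact step p hp hpN' a b ha hb h S hS

lemma bf_count (N : ℕ) (hN : 1 ≤ N) (a b : ℤ) (ha : 1 ≤ a) (hb : 1 ≤ b) (S : Finset (ℤ × ℤ))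
    (hS : ∀ z ∈ S, a * z.2 ^ 2 + b * z.1 ^ 2 = N) : S.card ≤ 10 * N.divisors.card ^ 3 := by
  classical
  set f : ℤ × ℤ → ℕ := fun z => Int.gcd z.1 z.2 with hf
  have hsq : ∀ z ∈ S, f z ^ 2 ∣ N := by
    intro z hz
    have h := hS z hz
    have h1 : ((f z : ℕ) : ℤ) ∣ z.1 := Int.gcd_dvd_left ..
    have h2 : ((f z : ℕ) : ℤ) ∣ z.2 := Int.gcd_dvd_right ..
    have : ((f z ^ 2 : ℕ) : ℤ) ∣ (N:ℤ) := by
      rw [← h]; push_cast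
      exact dvd_add ((pow_dvd_pow_of_dvd h2 2).mul_left _) ((pow_dvd_pow_of_dvd h1 2).mul_left _)
    exact_mod_cast this
  have hmaps : ∀ z ∈ S, f z ∈ N.divisors := by
    intro z hz
    rw [Nat.mem_divisors]
    exact ⟨(dvd_pow_self _ two_ne_zero).trans (hsq z hz), by omega⟩
  have hfib : ∀ e ∈ N.divisors, (S.filter (fun z => f z = e)).card ≤ 10 * N.divisors.card ^ 2 := by
    intro e he
    rcases (S.filter (fun z => f z = e)).eq_empty_or_nonempty with h | ⟨z1, hz1⟩
    · rw [h]; simp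
    obtain ⟨hz1S, hz1e⟩ := Finset.mem_filter.mp hz1
    obtain ⟨N', hN'⟩ := hsq z1 hz1S
    rw [hz1e] at hN'
    have he0 : e ≠ 0 := by
      rintro rfl; simp at he
    have hez : (e:ℤ) ≠ 0 := by exact_mod_cast he0
    have hN1 : 1 ≤ N' := by
      rcases Nat.eq_zero_or_pos N' with h | h
      · subst h; simp at hN'; omega
      · exact h
    have hdiv : N'.divisors.card ≤ N.divisors.card :=
      Finset.card_le_card (Nat.divisors_subset_of_dvd (by omega) ⟨e ^ 2, by rw [hN']; ring⟩)
    refine le_trans ?_ (Nat.mul_le_mul_left 10 (Nat.pow_le_pow_left hdiv 2))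
    set g : ℤ × ℤ → ℤ × ℤ := fun z => (z.1 / e, z.2 / e) with hg
    have hd : ∀ z ∈ S.filter (fun z => f z = e), (e:ℤ) * (z.1 / e) = z.1 ∧ (e:ℤ) * (z.2 / e) = z.2 := by
      intro z hz
      have hze := (Finset.mem_filter.mp hz).2
      rw [← hze]
      exact ⟨Int.mul_ediv_cancel' (Int.gcd_dvd_left ..), Int.mul_ediv_cancel' (Int.gcd_dvd_right ..)⟩
    have hinj : Set.InjOn g (S.filter (fun z => f z = e) : Finset (ℤ × ℤ)) := by
      intro z hz w hw h
      simp only [hg, Prod.mk.injEq] at h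
      have d1 := hd z hz
      have d2 := hd w hw
      rw [h.1, h.2] at d1
      exact Prod.ext (d1.1.symm.trans d2.1) (d1.2.symm.trans d2.2)
    rw [← Finset.card_image_of_injOn hinj]
    apply bf_primitive N' hN1 a b ha hb
    intro y hy
    obtain ⟨z, hz, rfl⟩ := Finset.mem_image.mp hy
    have d1 := hd z hz
    have hze := (Finset.mem_filter.mp hz).2
    have h1 := hS z (Finset.mem_filter.mp hz).1
    simp only [hg]
    constructor
    · rw [← d1.1, ← d1.2, hN'] at h1
      push_cast at h1
      have h7 : (e:ℤ) ^ 2 ≠ 0 := pow_ne_zero _ hez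
      apply mul_left_cancel₀ h7
      rw [d1.1, d1.2] at h1
      rw [← h1]
      linear_combination a * ((e:ℤ) * (z.2 / e) + z.2) * d1.2 + b * ((e:ℤ) * (z.1 / e) + z.1) * d1.1
    · rw [Int.isCoprime_iff_gcd_eq_one, ← hze]
      apply Int.gcd_ediv_gcd_ediv_gcd
      rw [hf] at hze; simp only at hze; omega
  have := Finset.card_le_mul_card_image_of_maps_to hmaps _ hfib
  calc S.card ≤ _ := this
    _ = _ := by ring

lemma gram_id (a1 a2 a3 b1 b2 b3 u1 u2 u3 : ℤ) :
    ((a2*b3-a3*b2)^2+(a3*b1-a1*b3)^2+(a1*b2-a2*b1)^2) * (u1^2+u2^2+u3^2)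
    = (u1*(a2*b3-a3*b2)+u2*(a3*b1-a1*b3)+u3*(a1*b2-a2*b1))^2
      + (b1^2+b2^2+b3^2)*(u1*a1+u2*a2+u3*a3)^2
      - 2*(a1*b1+a2*b2+a3*b3)*(u1*a1+u2*a2+u3*a3)*(u1*b1+u2*b2+u3*b3)
      + (a1^2+a2^2+a3^2)*(u1*b1+u2*b2+u3*b3)^2 := by ring

lemma sq_le_lin {x k : ℤ} (h : x ^ 2 ≤ k) : |x| ≤ k := by
  have : |x| ≤ |x| ^ 2 := by
    rcases eq_or_ne x 0 with rfl | h0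
    · simp
    · have := Int.one_le_abs h0; nlinarith
  rw [sq_abs] at this; linarith

lemma circle_inj (a1 a2 a3 b1 b2 b3 w1 w2 w3 : ℤ)
    (hc : (a2*b3-a3*b2)^2+(a3*b1-a1*b3)^2+(a1*b2-a2*b1)^2 ≠ 0)
    (e2 : w1 * a1 + w2 * a2 + w3 * a3 = 0) (e3 : w1 * b1 + w2 * b2 + w3 * b3 = 0)
    (e4 : w1 * (a2*b3-a3*b2) + w2 * (a3*b1-a1*b3) + w3 * (a1*b2-a2*b1) = 0) :
    w1 = 0 ∧ w2 = 0 ∧ w3 = 0 := by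
  have g := gram_id a1 a2 a3 b1 b2 b3 w1 w2 w3
  rw [e2, e3, e4] at g
  have g3 : w1^2 + w2^2 + w3^2 = 0 := by
    refine (mul_eq_zero.mp (g.trans ?_)).resolve_left hc
    ring
  have p1 := sq_nonneg w1
  have p2 := sq_nonneg w2
  have p3 := sq_nonneg w3
  refine ⟨?_, ?_, ?_⟩ <;> apply pow_eq_zero_iff two_ne_zero |>.mp <;> omega

lemma circle_size (M aa bb ab cc α β P Q A0 B0 X Y ξ uu N : ℤ) (hM0 : 0 ≤ M)
    (haa0 : 0 ≤ aa) (hbb0 : 0 ≤ bb) (hcc0 : 0 ≤ cc) (hP0 : 0 ≤ P)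
    (hα2 : α^2 ≤ 16*M) (hβ2 : β^2 ≤ 16*M) (haale : aa ≤ 16*M) (hbble : bb ≤ 16*M)
    (hA : |A0| ≤ 4 * M) (hB : |B0| ≤ 4 * M)
    (hlag : cc = aa*bb - ab^2) (hPb : P ≤ cc + 2*(bb*α^2) + 2*(aa*β^2))
    (hQ : Q = -2*bb*A0*α + 2*ab*(A0*β+B0*α) - 2*aa*B0*β)
    (hX : X = 2*P*ξ+Q) (hξ2 : ξ^2 ≤ M) (huM : uu ≤ M) (hcs : Y^2 ≤ uu * cc)
    (hN : N = 4*P*Y^2+1*X^2) : N ≤ 2 * 10^8 * M^6 := by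
  have hαl := sq_le_lin hα2
  have hβl := sq_le_lin hβ2
  have hξ := sq_le_lin hξ2
  have haabb : aa*bb ≤ 256*M^2 := by
    calc aa*bb ≤ (16*M)*(16*M) := mul_le_mul haale hbble hbb0 (by positivity)
      _ = _ := by ring
  have hccle : cc ≤ 256*M^2 := by linarith [sq_nonneg ab]
  have hab2 : ab^2 ≤ (16*M)^2 := by
    have : (16*M)^2 = 256*M^2 := by ring
    linarith
  have habl : |ab| ≤ 16*M := abs_le_of_sq_le_sq hab2 (by positivity)
  have hPle : P ≤ 1280*M^2 := by
    have h1 : bb*α^2 ≤ 256*M^2 := by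
      calc bb*α^2 ≤ (16*M)*(16*M) := mul_le_mul hbble hα2 (by positivity) (by positivity)
        _ = _ := by ring
    have h2 : aa*β^2 ≤ 256*M^2 := by
      calc aa*β^2 ≤ (16*M)*(16*M) := mul_le_mul haale hβ2 (by positivity) (by positivity)
        _ = _ := by ring
    linarith
  have hQle : |Q| ≤ 8192*M^3 := by
    have q1 : |bb*A0*α| ≤ (16*M)*(4*M)*(16*M) := by
      rw [abs_mul, abs_mul, abs_of_nonneg hbb0]; gcongr
    have q2 : |ab*(A0*β)| ≤ (16*M)*((4*M)*(16*M)) := by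
      rw [abs_mul, abs_mul]; gcongr
    have q3 : |ab*(B0*α)| ≤ (16*M)*((4*M)*(16*M)) := by
      rw [abs_mul, abs_mul]; gcongr
    have q4 : |aa*B0*β| ≤ (16*M)*(4*M)*(16*M) := by
      rw [abs_mul, abs_mul, abs_of_nonneg haa0]; gcongr
    rw [abs_le] at q1 q2 q3 q4 ⊢
    obtain ⟨q1, q1'⟩ := q1
    obtain ⟨q2, q2'⟩ := q2
    obtain ⟨q3, q3'⟩ := q3
    obtain ⟨q4, q4'⟩ := q4
    have hq : Q = -2*(bb*A0*α) + 2*(ab*(A0*β)) + 2*(ab*(B0*α)) - 2*(aa*B0*β) := by rw [hQ]; ring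
    ring_nf at q1 q1' q2 q2' q3 q3' q4 q4' hq ⊢
    constructor <;> linarith
  have hXle : |X| ≤ 10752*M^3 := by
    have : |2*P*ξ| ≤ 2*(1280*M^2)*M := by
      rw [abs_mul, abs_of_nonneg (by omega : 0 ≤ 2*P)]; gcongr
    calc |X| ≤ |2*P*ξ| + |Q| := by rw [hX]; exact abs_add_le _ _
      _ ≤ 2*(1280*M^2)*M + 8192*M^3 := add_le_add this hQle
      _ = _ := by ring
  have hYle : Y^2 ≤ 256*M^3 := by
    calc _ ≤ _ := hcs
      _ ≤ M * (256*M^2) := mul_le_mul huM hccle hcc0 hM0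
      _ = _ := by ring
  have hX2 : X^2 ≤ (10752*M^3)^2 := by
    rw [← sq_abs]; gcongr
  have hPY : 4*P*Y^2 ≤ 4*(1280*M^2)*(256*M^3) := by gcongr
  have hM1 : M^5 ≤ M^6 := by
    rcases eq_or_lt_of_le hM0 with h | h
    · rw [← h]; simp
    · exact pow_le_pow_right₀ (by omega) (by norm_num)
  have hM6 := pow_nonneg hM0 6
  rw [hN]
  ring_nf at hX2 hPY ⊢
  linarith

set_option maxHeartbeats 1000000 in
lemma circle0 (m : ℕ) (n n' : Fin 4 → ℤ) (A0 B0 : ℤ) (hn : ∑ i, n i ^ 2 ≤ 16 * m)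
    (hn' : ∑ i, n' i ^ 2 ≤ 16 * m) (hA : |A0| ≤ 4 * m) (hB : |B0| ≤ 4 * m)
    (hmin : n 0 * n' 1 - n 1 * n' 0 ≠ 0) (S : Finset (Fin 4 → ℤ))
    (hS : ∀ x ∈ S, ∑ i, x i ^ 2 = m ∧ ∑ i, x i * n i = A0 ∧ ∑ i, x i * n' i = B0)
    (T : ℕ) (hT : ∀ N : ℕ, N ≠ 0 → N ≤ 2 * 10 ^ 8 * m ^ 6 → 10 * N.divisors.card ^ 3 ≤ T)
    (hT1 : 1 ≤ T) :
    S.card ≤ T := by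
  classical
  simp only [Fin.sum_univ_four] at hn hn' hS
  obtain ⟨a1, ha1⟩ : ∃ t, t = n 0 := ⟨_, rfl⟩
  obtain ⟨a2, ha2⟩ : ∃ t, t = n 1 := ⟨_, rfl⟩
  obtain ⟨a3, ha3⟩ : ∃ t, t = n 2 := ⟨_, rfl⟩
  obtain ⟨α, hα⟩ : ∃ t, t = n 3 := ⟨_, rfl⟩
  obtain ⟨b1, hb1⟩ : ∃ t, t = n' 0 := ⟨_, rfl⟩
  obtain ⟨b2, hb2⟩ : ∃ t, t = n' 1 := ⟨_, rfl⟩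
  obtain ⟨b3, hb3⟩ : ∃ t, t = n' 2 := ⟨_, rfl⟩
  obtain ⟨β, hβ⟩ : ∃ t, t = n' 3 := ⟨_, rfl⟩
  rw [← ha1, ← ha2, ← ha3, ← hα] at hn
  rw [← hb1, ← hb2, ← hb3, ← hβ] at hn'
  rw [← ha1, ← ha2, ← hb1, ← hb2] at hmin
  simp only [← ha1, ← ha2, ← ha3, ← hα, ← hb1, ← hb2, ← hb3, ← hβ] at hS
  obtain ⟨c1, hc1⟩ : ∃ t : ℤ, t = a2*b3-a3*b2 := ⟨_, rfl⟩
  obtain ⟨c2, hc2⟩ : ∃ t : ℤ, t = a3*b1-a1*b3 := ⟨_, rfl⟩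
  obtain ⟨c3, hc3⟩ : ∃ t : ℤ, t = a1*b2-a2*b1 := ⟨_, rfl⟩
  obtain ⟨aa, haa⟩ : ∃ t : ℤ, t = a1^2+a2^2+a3^2 := ⟨_, rfl⟩
  obtain ⟨bb, hbb⟩ : ∃ t : ℤ, t = b1^2+b2^2+b3^2 := ⟨_, rfl⟩
  obtain ⟨ab, hab⟩ : ∃ t : ℤ, t = a1*b1+a2*b2+a3*b3 := ⟨_, rfl⟩
  obtain ⟨cc, hcc⟩ : ∃ t : ℤ, t = c1^2+c2^2+c3^2 := ⟨_, rfl⟩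
  have hccpos : 1 ≤ cc := by
    have : 0 < c3 ^ 2 := by rw [hc3]; positivity
    have h1 := sq_nonneg c1
    have h2 := sq_nonneg c2
    omega
  have haa0 : 0 ≤ aa := by rw [haa]; positivity
  have hbb0 : 0 ≤ bb := by rw [hbb]; positivity
  obtain ⟨P, hP⟩ : ∃ t : ℤ, t = cc + (bb*α^2 - 2*ab*α*β + aa*β^2) := ⟨_, rfl⟩
  have hP' : P = cc + ((α*b1-β*a1)^2+(α*b2-β*a2)^2+(α*b3-β*a3)^2) := by
    simp only [hP, hbb, hab, haa]; ring
  have hPpos : 1 ≤ P := by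
    rw [hP']
    linarith [sq_nonneg (α*b1-β*a1), sq_nonneg (α*b2-β*a2), sq_nonneg (α*b3-β*a3)]
  have hcc0 : 0 < cc := lt_of_lt_of_le one_pos hccpos
  have hP0 : 0 < P := lt_of_lt_of_le one_pos hPpos
  have h2P : 2 * P ≠ 0 := (mul_pos two_pos hP0).ne'
  have h4P : 1 ≤ 4 * P := by linarith only [hPpos]
  obtain ⟨Q, hQ⟩ : ∃ t : ℤ, t = -2*bb*A0*α + 2*ab*(A0*β+B0*α) - 2*aa*B0*β := ⟨_, rfl⟩
  obtain ⟨R, hR⟩ : ∃ t : ℤ, t = bb*A0^2 - 2*ab*A0*B0 + aa*B0^2 - cc*m := ⟨_, rfl⟩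
  set X : (Fin 4 → ℤ) → ℤ := fun x => 2*P*x 3 + Q with hX
  set Y : (Fin 4 → ℤ) → ℤ := fun x => x 0 * c1 + x 1 * c2 + x 2 * c3 with hY
  have key : ∀ x ∈ S, 4*P*(Y x)^2 + 1*(X x)^2 = Q^2-4*P*R := by
    intro x hx
    obtain ⟨h1, h2, h3⟩ := hS x hx
    have g := gram_id a1 a2 a3 b1 b2 b3 (x 0) (x 1) (x 2)
    have e1 : x 0 ^ 2 + x 1 ^ 2 + x 2 ^ 2 = m - x 3 ^ 2 := by linarith
    have e2 : x 0 * a1 + x 1 * a2 + x 2 * a3 = A0 - x 3 * α := by linarith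
    have e3 : x 0 * b1 + x 1 * b2 + x 2 * b3 = B0 - x 3 * β := by linarith
    rw [e1, e2, e3] at g
    have g' : (Y x)^2 + P * x 3 ^ 2 + Q * x 3 + R = 0 := by
      simp only [hY, hP, hQ, hR, hcc, hc1, hc2, hc3, hbb, hab, haa]
      linear_combination - g
    simp only [hX]
    linear_combination 4 * P * g'
  have hinj : Set.InjOn (fun x => (X x, Y x)) (S : Set (Fin 4 → ℤ)) := by
    intro x hx y hy hxy
    simp only [Prod.mk.injEq] at hxy
    obtain ⟨hx1, hy1⟩ := hxy
    have h3 : x 3 = y 3 := by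
      have hx2 : 2 * P * x 3 + Q = 2 * P * y 3 + Q := hx1
      have : 2 * P * x 3 = 2 * P * y 3 := add_right_cancel hx2
      exact mul_left_cancel₀ h2P this
    obtain ⟨h1, h2, h4⟩ := hS x hx
    obtain ⟨h1', h2', h4'⟩ := hS y hy
    obtain ⟨z0, z1, z2⟩ := circle_inj a1 a2 a3 b1 b2 b3 (x 0 - y 0) (x 1 - y 1) (x 2 - y 2)
      (by rw [← hc1, ← hc2, ← hc3, ← hcc]; exact hcc0.ne') (by linear_combination h2 - h2' - α * h3)
      (by linear_combination h4 - h4' - β * h3)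
      (by
        change x 0 * c1 + x 1 * c2 + x 2 * c3 = y 0 * c1 + y 1 * c2 + y 2 * c3 at hy1
        rw [← hc1, ← hc2, ← hc3]
        linear_combination hy1)
    funext i
    fin_cases i
    · exact sub_eq_zero.mp z0
    · exact sub_eq_zero.mp z1
    · exact sub_eq_zero.mp z2
    · exact h3
  rcases S.eq_empty_or_nonempty with rfl | ⟨x0, hx0⟩
  · simp
  rw [← Finset.card_image_of_injOn hinj]
  obtain ⟨N0, hN0⟩ : ∃ t : ℤ, t = Q^2-4*P*R := ⟨_, rfl⟩
  rw [← hN0] at key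
  have hN0nn : 0 ≤ N0 := by
    rw [← key x0 hx0]; positivity
  obtain ⟨N, hN⟩ := Int.eq_ofNat_of_zero_le hN0nn
  rcases Nat.eq_zero_or_pos N with hz | hpos
  · -- single point
    refine le_trans ?_ hT1
    rw [Finset.card_le_one]
    have hz2 : ∀ x ∈ S, X x = 0 ∧ Y x = 0 := by
      intro x hx
      have k := key x hx
      rw [hN, hz] at k
      simp only [Nat.cast_zero] at k
      have : 0 ≤ P * (Y x)^2 := by positivity
      have hx' : X x = 0 := by
        apply pow_eq_zero_iff two_ne_zero |>.mp
        linarith only [sq_nonneg (X x), k, this]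
      refine ⟨hx', ?_⟩
      apply pow_eq_zero_iff two_ne_zero |>.mp
      have h4 : P * (Y x)^2 = 0 := by linarith only [sq_nonneg (X x), k, this]
      exact (mul_eq_zero.mp h4).resolve_left hP0.ne'
    intro p hp q hq
    obtain ⟨x, hx, rfl⟩ := Finset.mem_image.mp hp
    obtain ⟨y, hy, rfl⟩ := Finset.mem_image.mp hq
    simp [hz2 x hx, hz2 y hy]
  · have hb := bf_count N hpos (4*P) 1 h4P le_rfl (S.image (fun x => (X x, Y x))) (by
      intro z hz
      obtain ⟨x, hx, rfl⟩ := Finset.mem_image.mp hz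
      have := key x hx
      rw [hN] at this
      exact this)
    refine hb.trans (hT N (by omega) ?_)
    obtain ⟨h1, h2, h3⟩ := hS x0 hx0
    have k := key x0 hx0
    rw [hN] at k
    have hs := circle_size (m:ℤ) aa bb ab cc α β P Q A0 B0 (X x0) (Y x0) (x0 3)
      (x0 0 ^ 2 + x0 1 ^ 2 + x0 2 ^2) N (by positivity) haa0 hbb0 hcc0.le hP0.le
      (by linarith only [hn, sq_nonneg a1, sq_nonneg a2, sq_nonneg a3])
      (by linarith only [hn', sq_nonneg b1, sq_nonneg b2, sq_nonneg b3])
      (by rw [haa]; linarith only [hn, sq_nonneg α]) (by rw [hbb]; linarith only [hn', sq_nonneg β]) hA hB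
      (by rw [hcc, hc1, hc2, hc3, hbb, hab, haa]; ring)
      (by
        have h3 : P + ((α*b1+β*a1)^2+(α*b2+β*a2)^2+(α*b3+β*a3)^2)
            = cc + 2*(bb*α^2) + 2*(aa*β^2) := by
          rw [hP', hbb, haa]; ring
        linarith only [h3, sq_nonneg (α*b1+β*a1), sq_nonneg (α*b2+β*a2), sq_nonneg (α*b3+β*a3)])
      hQ rfl (by linarith only [h1, sq_nonneg (x0 0), sq_nonneg (x0 1), sq_nonneg (x0 2)])
      (by linarith only [h1, sq_nonneg (x0 3)])
      (by
        have : (x0 0 ^ 2 + x0 1 ^ 2 + x0 2 ^2) * (c1^2+c2^2+c3^2) - (x0 0 * c1 + x0 1 * c2 + x0 2 * c3)^2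
          = (x0 0 * c2 - x0 1 * c1)^2 + (x0 0 * c3 - x0 2 * c1)^2 + (x0 1 * c3 - x0 2 * c2)^2 := by ring
        rw [hcc]
        change (x0 0 * c1 + x0 1 * c2 + x0 2 * c3)^2 ≤ _ * (c1^2+c2^2+c3^2)
        linarith only [this, sq_nonneg (x0 0 * c2 - x0 1 * c1), sq_nonneg (x0 0 * c3 - x0 2 * c1), sq_nonneg (x0 1 * c3 - x0 2 * c2)])
      k.symm
    exact_mod_cast hs

lemma exists_perm01 (i j : Fin 4) (h : i ≠ j) : ∃ e : Equiv.Perm (Fin 4), e 0 = i ∧ e 1 = j := by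
  refine ⟨(Equiv.swap 1 (Equiv.swap 0 i j)).trans (Equiv.swap 0 i), ?_, ?_⟩
  · revert i j; decide
  · revert i j; decide

lemma circle1 (m : ℕ) (d d' : Fin 4 → ℤ) (hd0 : d ≠ 0) (hd0' : d' ≠ 0) (hne : d ≠ d')
    (hd : ∑ i, d i ^ 2 ≤ 4 * m) (hd' : ∑ i, d' i ^ 2 ≤ 4 * m) (S : Finset (Fin 4 → ℤ))
    (hS : ∀ x ∈ S, ∑ i, x i ^ 2 = m ∧ 2 * ∑ i, x i * d i = ∑ i, d i ^ 2 ∧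
      2 * ∑ i, x i * d' i = ∑ i, d' i ^ 2)
    (T : ℕ) (hT : ∀ N : ℕ, N ≠ 0 → N ≤ 2 * 10 ^ 8 * m ^ 6 → 10 * N.divisors.card ^ 3 ≤ T)
    (hT1 : 1 ≤ T) :
    S.card ≤ T := by
  classical
  rcases S.eq_empty_or_nonempty with rfl | ⟨x0, hx0⟩
  · simp
  have hminor : ∃ i j, d i * d' j - d j * d' i ≠ 0 := by
    by_contra hcon
    push Not at hcon
    obtain ⟨i, hi⟩ : ∃ i, d i ≠ 0 := by
      by_contra h; push Not at h; exact hd0 (funext h)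
    have hpar : ∀ j, d i * d' j = d' i * d j := fun j => by linarith [hcon i j]
    obtain ⟨_, h1, h2⟩ := hS x0 hx0
    have e1 : d i ^ 2 * ∑ j, d' j ^ 2 = d' i ^ 2 * ∑ j, d j ^ 2 := by
      rw [Finset.mul_sum, Finset.mul_sum]
      apply Finset.sum_congr rfl; intro j _
      rw [← mul_pow, ← mul_pow, hpar]
    have e2 : d i * ∑ j, x0 j * d' j = d' i * ∑ j, x0 j * d j := by
      rw [Finset.mul_sum, Finset.mul_sum]
      apply Finset.sum_congr rfl; intro j _
      linear_combination x0 j * hpar j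
    have hpos : 0 < ∑ j, d j ^ 2 := by
      apply Finset.sum_pos' (fun j _ => sq_nonneg _) ⟨i, Finset.mem_univ _, by positivity⟩
    have e3 : d' i * (d' i - d i) * ∑ j, d j ^ 2 = 0 := by
      linear_combination -e1 + 2 * d i * e2 - d i ^ 2 * h2 + d i * d' i * h1
    rcases mul_eq_zero.mp e3 with h | h
    · rcases mul_eq_zero.mp h with h | h
      · apply hd0'; funext j
        have := hpar j
        rw [h, zero_mul] at this
        exact (mul_eq_zero.mp this).resolve_left hi
      · apply hne; funext j
        have h5 : d' i = d i := by linarith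
        have := hpar j
        rw [h5] at this
        exact (mul_left_cancel₀ hi this).symm
    · exact hpos.ne' h
  obtain ⟨i, j, hij⟩ := hminor
  have hijne : i ≠ j := by
    rintro rfl; apply hij; ring
  obtain ⟨e, he0, he1⟩ := exists_perm01 i j hijne
  set g : (Fin 4 → ℤ) → (Fin 4 → ℤ) := fun x => x ∘ e with hg
  have hginj : Function.Injective g := by
    intro x y h
    funext k
    have := congrFun h (e.symm k)
    simpa [hg] using this
  rw [← Finset.card_image_of_injective S hginj]
  have hsum : ∀ f : Fin 4 → ℤ, ∑ k, f (e k) = ∑ k, f k := fun f => Equiv.sum_comp e f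
  have hnn : 0 ≤ ∑ i, d i ^ 2 := Finset.sum_nonneg (fun _ _ => sq_nonneg _)
  have hnn' : 0 ≤ ∑ i, d' i ^ 2 := Finset.sum_nonneg (fun _ _ => sq_nonneg _)
  apply circle0 m (fun k => 2 * d (e k)) (fun k => 2 * d' (e k)) (∑ i, d i ^ 2) (∑ i, d' i ^ 2)
    ?_ ?_ ?_ ?_ ?_ _ ?_ T hT hT1
  · have := hsum (fun k => (2 * d k) ^ 2)
    rw [this]; simp only [mul_pow, ← Finset.mul_sum]; linarith
  · have := hsum (fun k => (2 * d' k) ^ 2)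
    rw [this]; simp only [mul_pow, ← Finset.mul_sum]; linarith
  · rw [abs_of_nonneg hnn]; exact hd
  · rw [abs_of_nonneg hnn']; exact hd'
  · rw [he0, he1]; intro h; apply hij; linarith
  · intro y hy
    obtain ⟨x, hx, rfl⟩ := Finset.mem_image.mp hy
    obtain ⟨h1, h2, h3⟩ := hS x hx
    refine ⟨?_, ?_, ?_⟩
    · rw [← h1]; exact hsum (fun k => x k ^ 2)
    · rw [← h2, Finset.mul_sum, ← hsum (fun k => 2 * (x k * d k))]
      apply Finset.sum_congr rfl; intro k _; simp only [hg, Function.comp]; ring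
    · rw [← h3, Finset.mul_sum, ← hsum (fun k => 2 * (x k * d' k))]
      apply Finset.sum_congr rfl; intro k _; simp only [hg, Function.comp]; ring

lemma class_cs {α β γ : Type*} [DecidableEq γ] (X : Finset α) (Y : Finset β) (R : α → β → Prop)
    [∀ x y, Decidable (R x y)] (c : α → γ) (Q0 : Finset (α × β))
    (hQ0 : ∀ x ∈ X, ∀ y ∈ Y, ∀ x' ∈ X, c x' = c x → R x' y → (x, y) ∈ Q0) :
    (∑ x ∈ X, ((Y.filter (fun y => R x y)).card : ℝ)) ^ 2 ≤
      (Q0.card : ℝ) *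
      ∑ x ∈ X, ∑ x' ∈ X.filter (fun x' => c x' = c x),
        ((Y.filter (fun y => R x y ∧ R x' y)).card : ℝ) / ((X.filter (fun x' => c x' = c x)).card : ℝ) := by
  classical
  set n : α → ℝ := fun x => ((X.filter (fun x' => c x' = c x)).card : ℝ) with hn
  set w : α → α → ℝ := fun x x' => if c x = c x' then 1 else 0 with hw
  set ρ : α → β → ℝ := fun x y => if R x y then 1 else 0 with hρ
  set g : α × β → ℝ := fun p => (∑ x' ∈ X, w p.1 x' * ρ x' p.2) / n p.1 with hg
  have npos : ∀ x ∈ X, 0 < n x := by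
    intro x hx
    simp only [hn]
    exact_mod_cast Finset.card_pos.mpr ⟨x, by simp [hx]⟩
  have ncongr : ∀ x x', c x = c x' → n x = n x' := by
    intro x x' h; simp only [hn, h]
  have wsum : ∀ x' ∈ X, ∑ x ∈ X, w x x' / n x = 1 := by
    intro x' hx'
    have : ∀ x ∈ X, w x x' / n x = (if c x = c x' then 1 else 0) / n x' := by
      intro x _
      simp only [hw]
      split_ifs with h
      · rw [ncongr x x' h]
      · simp
    rw [Finset.sum_congr rfl this, ← Finset.sum_div, Finset.sum_boole]
    exact div_self (npos x' hx').ne'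
  have h1 : ∑ x ∈ X, ((Y.filter (fun y => R x y)).card : ℝ) = ∑ p ∈ X ×ˢ Y, g p := by
    rw [Finset.sum_product_right]
    simp only [hg, Finset.sum_div]
    have e : ∀ y ∈ Y, ∑ x ∈ X, ∑ x' ∈ X, w x x' * ρ x' y / n x = ∑ x' ∈ X, ρ x' y := by
      intro y _
      rw [Finset.sum_comm]
      apply Finset.sum_congr rfl
      intro x' hx'
      calc ∑ x ∈ X, w x x' * ρ x' y / n x = ρ x' y * ∑ x ∈ X, w x x' / n x := by
            rw [Finset.mul_sum]; apply Finset.sum_congr rfl; intros; ring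
        _ = _ := by rw [wsum x' hx', mul_one]
    rw [Finset.sum_congr rfl e, Finset.sum_comm]
    apply Finset.sum_congr rfl
    intro x _
    simp [hρ]
  set Q := (X ×ˢ Y).filter (fun p => ∃ x' ∈ X, c x' = c p.1 ∧ R x' p.2) with hQ
  have h2 : ∑ p ∈ X ×ˢ Y, g p = ∑ p ∈ Q, g p := by
    symm
    apply Finset.sum_subset (Finset.filter_subset _ _)
    intro p hp hpQ
    simp only [hg]
    rw [Finset.sum_eq_zero, zero_div]
    intro x' hx'
    simp only [hw, hρ]
    by_cases h : c p.1 = c x' ∧ R x' p.2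
    · exact absurd (Finset.mem_filter.mpr ⟨hp, x', hx', h.1.symm, h.2⟩) hpQ
    · rw [not_and_or] at h
      rcases h with h | h <;> simp [h]
  have h3 : (∑ p ∈ Q, g p) ^ 2 ≤ Q.card * ∑ p ∈ Q, g p ^ 2 := sq_sum_le_card_mul_sum_sq
  have h4 : ∑ p ∈ Q, g p ^ 2 ≤ ∑ p ∈ X ×ˢ Y, g p ^ 2 :=
    Finset.sum_le_sum_of_subset_of_nonneg (Finset.filter_subset _ _) (fun _ _ _ => sq_nonneg _)
  have h5 : ∑ p ∈ X ×ˢ Y, g p ^ 2 = ∑ x ∈ X, ∑ x' ∈ X.filter (fun x' => c x' = c x),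
        ((Y.filter (fun y => R x y ∧ R x' y)).card : ℝ) / n x := by
    rw [Finset.sum_product_right]
    have e : ∀ y ∈ Y, ∑ x ∈ X, g (x, y) ^ 2 =
        ∑ x ∈ X, ∑ x' ∈ X, w x x' / n x * (ρ x y * ρ x' y) := by
      intro y _
      have e1 : ∀ x ∈ X, g (x, y) ^ 2 = ∑ x1 ∈ X, ∑ x2 ∈ X,
          (w x x1 / n x) * (w x1 x2 / n x1 * (ρ x1 y * ρ x2 y)) := by
        intro x _
        simp only [hg]
        rw [sq, Finset.sum_div, Finset.sum_mul_sum]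
        apply Finset.sum_congr rfl; intro x1 _
        apply Finset.sum_congr rfl; intro x2 _
        simp only [hw]
        by_cases h1 : c x = c x1
        · rw [ncongr x x1 h1, h1]; simp only [if_true]; ring
        · simp [h1]
      rw [Finset.sum_congr rfl e1, Finset.sum_comm]
      apply Finset.sum_congr rfl; intro x1 hx1
      rw [Finset.sum_comm]
      apply Finset.sum_congr rfl; intro x2 _
      rw [← Finset.sum_mul, wsum x1 hx1, one_mul]
    rw [Finset.sum_congr rfl e, Finset.sum_comm]
    apply Finset.sum_congr rfl; intro x _
    rw [Finset.sum_comm, Finset.sum_filter]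
    apply Finset.sum_congr rfl; intro x' _
    rw [← Finset.mul_sum]
    have : ∑ y ∈ Y, ρ x y * ρ x' y = ((Y.filter (fun y => R x y ∧ R x' y)).card : ℝ) := by
      rw [← Finset.sum_boole]
      apply Finset.sum_congr rfl; intro y _
      simp only [hρ]
      by_cases h1 : R x y <;> by_cases h2 : R x' y <;> simp [h1, h2]
    rw [this]
    by_cases h : c x' = c x
    · rw [if_pos h]
      have hw1 : w x x' = 1 := if_pos h.symm
      rw [hw1]; ring
    · rw [if_neg h]
      have hw1 : w x x' = 0 := if_neg (fun h' => h h'.symm)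
      rw [hw1]; ring
  have hQQ : Q ⊆ Q0 := by
    intro p hp
    obtain ⟨hp, x', hx', hc, hR⟩ := Finset.mem_filter.mp hp
    obtain ⟨hp1, hp2⟩ := Finset.mem_product.mp hp
    exact hQ0 p.1 hp1 p.2 hp2 x' hx' hc hR
  have hQc : (Q.card : ℝ) ≤ Q0.card := by exact_mod_cast Finset.card_le_card hQQ
  rw [h1, h2]
  refine h3.trans ?_
  rw [← h5]
  exact mul_le_mul hQc h4 (Finset.sum_nonneg (fun _ _ => sq_nonneg _)) (Nat.cast_nonneg _)

abbrev V4 := Fin 4 → ℤ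

/-- representation function -/
def rr (A : Finset V4) (d : V4) : ℕ := (A.filter (fun x => x - d ∈ A)).card

def FF (d x : V4) : ℤ := ∑ i, d i ^ 2 - 2 * ∑ i, x i * d i

def Dl (A : Finset V4) : Finset V4 := ((A ×ˢ A).image (fun p => p.1 - p.2)).erase 0

lemma FF_eq_zero {m : ℕ} {d x : V4} (h1 : ∑ i, x i ^ 2 = (m:ℤ)) (h2 : ∑ i, (x - d) i ^ 2 = (m:ℤ)) :
    FF d x = 0 := by
  have : ∑ i, (x - d) i ^ 2 = ∑ i, x i ^ 2 - 2 * ∑ i, x i * d i + ∑ i, d i ^ 2 := by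
    rw [Finset.mul_sum, ← Finset.sum_sub_distrib, ← Finset.sum_add_distrib]
    apply Finset.sum_congr rfl; intro i _; simp only [Pi.sub_apply]; ring
  unfold FF; linarith

/-- The bundle of hypotheses used throughout. -/
structure Good (A : Finset V4) (m : ℕ) (T : ℝ) : Prop where
  sph : ∀ x ∈ A, ∑ i, x i ^ 2 = (m:ℤ)
  one_le : 1 ≤ T
  t1 : ∀ n : ℕ, n ≠ 0 → n ≤ 9 * m → (n.divisors.card : ℝ) ≤ T
  t2 : ∀ d ∈ Dl A, ∀ d' ∈ Dl A, d ≠ d' →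
    ((A.filter (fun x => FF d x = 0 ∧ FF d' x = 0)).card : ℝ) ≤ T
  t3 : (Nat.log 2 A.card : ℝ) + 1 ≤ T

lemma Dl_norm {A : Finset V4} {m : ℕ} (hA : ∀ x ∈ A, ∑ i, x i ^ 2 = (m:ℤ)) {d : V4} (hd : d ∈ Dl A) :
    ∑ i, d i ^ 2 ≤ 4 * (m:ℤ) := by
  classical
  obtain ⟨_, h⟩ := Finset.mem_erase.mp hd
  obtain ⟨⟨x, y⟩, hp, rfl⟩ := Finset.mem_image.mp h
  obtain ⟨hx, hy⟩ := Finset.mem_product.mp hp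
  have h1 := hA x hx
  have h2 := hA y hy
  calc ∑ i, (x - y) i ^ 2 ≤ ∑ i, (2 * x i ^ 2 + 2 * y i ^ 2) := by
        apply Finset.sum_le_sum; intro i _; simp only [Pi.sub_apply]
        nlinarith [sq_nonneg (x i + y i)]
    _ = 4 * (m:ℤ) := by
        rw [Finset.sum_add_distrib, ← Finset.mul_sum, ← Finset.mul_sum]; rw [h1, h2]; ring

lemma FF_bound {A : Finset V4} {m : ℕ} (hA : ∀ x ∈ A, ∑ i, x i ^ 2 = (m:ℤ)) {d : V4} (hd : d ∈ Dl A)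
    {x : V4} (hx : x ∈ A) : (FF d x).natAbs ≤ 9 * m := by
  have h1 := Dl_norm hA hd
  have h2 := hA x hx
  have h0 : 0 ≤ ∑ i, d i ^ 2 := Finset.sum_nonneg (fun _ _ => sq_nonneg _)
  have h3 : 2 * ∑ i, x i * d i ≤ 5 * (m:ℤ) := by
    calc 2 * ∑ i, x i * d i ≤ ∑ i, (x i ^ 2 + d i ^ 2) := by
          rw [Finset.mul_sum]; apply Finset.sum_le_sum; intro i _; nlinarith [sq_nonneg (x i - d i)]
      _ ≤ _ := by rw [Finset.sum_add_distrib]; linarith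
  have h4 : - (5 * (m:ℤ)) ≤ 2 * ∑ i, x i * d i := by
    calc _ ≤ ∑ i, (-(x i ^ 2 + d i ^ 2)) := by
          rw [Finset.sum_neg_distrib, Finset.sum_add_distrib]; linarith
      _ ≤ _ := by rw [Finset.mul_sum]; apply Finset.sum_le_sum; intro i _; nlinarith [sq_nonneg (x i + d i)]
  unfold FF
  omega

def I0 (D A : Finset V4) : ℕ := ((D ×ˢ A).filter (fun p => FF p.1 p.2 = 0)).card

def Iq (D A : Finset V4) (q : ℕ) : ℕ := ((D ×ˢ A).filter (fun p => (q:ℤ) ∣ FF p.1 p.2)).card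

lemma card_Ioc_dvd (n : ℤ) (hn : n ≠ 0) (ρ : ℕ) :
    ((Finset.Ioc ρ (2*ρ)).filter (fun q : ℕ => (q:ℤ) ∣ n)).card ≤ n.natAbs.divisors.card := by
  apply Finset.card_le_card
  intro q hq
  rw [Nat.mem_divisors]
  refine ⟨Int.natCast_dvd.mp (Finset.mem_filter.mp hq).2, by simpa using hn⟩

lemma sum_Iq {A : Finset V4} {m : ℕ} {T : ℝ} (G : Good A m T) (D : Finset V4) (hD : D ⊆ Dl A) (ρ : ℕ) :
    ∑ q ∈ Finset.Ioc ρ (2*ρ), (Iq D A q : ℝ) ≤ ρ * I0 D A + T * D.card * A.card := by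
  classical
  have e : ∀ q ∈ Finset.Ioc ρ (2*ρ), (Iq D A q : ℝ) = ∑ p ∈ D ×ˢ A, if (q:ℤ) ∣ FF p.1 p.2 then (1:ℝ) else 0 := by
    intro q _
    rw [Finset.sum_boole, Iq]
  rw [Finset.sum_congr rfl e, Finset.sum_comm]
  have b : ∀ p ∈ D ×ˢ A, (∑ q ∈ Finset.Ioc ρ (2*ρ), if (q:ℤ) ∣ FF p.1 p.2 then (1:ℝ) else 0)
      ≤ ρ * (if FF p.1 p.2 = 0 then 1 else 0) + T := by
    intro p hp
    obtain ⟨hp1, hp2⟩ := Finset.mem_product.mp hp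
    have hT := G.one_le
    by_cases h : FF p.1 p.2 = 0
    · simp only [h, dvd_zero, if_true]
      rw [Finset.sum_const, Nat.card_Ioc]
      have : 2 * ρ - ρ = ρ := by omega
      rw [this]; simp; linarith
    · rw [Finset.sum_boole]
      have h1 := card_Ioc_dvd _ h ρ
      have h2 := G.t1 _ (Int.natAbs_ne_zero.mpr h) (FF_bound G.sph (hD hp1) hp2)
      have h3 : (((Finset.Ioc ρ (2*ρ)).filter (fun q : ℕ => (q:ℤ) ∣ FF p.1 p.2)).card : ℝ) ≤ T :=
        le_trans (by exact_mod_cast h1) h2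
      simpa [h] using h3
  refine (Finset.sum_le_sum b).trans ?_
  rw [Finset.sum_add_distrib, ← Finset.mul_sum, Finset.sum_boole, Finset.sum_const, Finset.card_product, I0]
  apply le_of_eq
  simp only [nsmul_eq_mul]; push_cast; ring

lemma kst {A : Finset V4} {m : ℕ} {T : ℝ} (G : Good A m T) (D : Finset V4) (hD : D ⊆ Dl A) :
    (I0 D A : ℝ) ^ 2 ≤ A.card * (T * D.card ^ 2 + I0 D A) := by
  classical
  set ρ : V4 → V4 → ℝ := fun d x => if FF d x = 0 then 1 else 0 with hρ
  have h1 : (I0 D A : ℝ) = ∑ x ∈ A, ∑ d ∈ D, ρ d x := by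
    rw [← Finset.sum_product_right (s := D) (t := A) (f := fun p => ρ p.1 p.2)]
    simp only [hρ]
    rw [Finset.sum_boole, I0]
  have h2 : (∑ x ∈ A, ∑ d ∈ D, ρ d x) ^ 2 ≤ A.card * ∑ x ∈ A, (∑ d ∈ D, ρ d x) ^ 2 := sq_sum_le_card_mul_sum_sq
  have h3 : ∑ x ∈ A, (∑ d ∈ D, ρ d x) ^ 2 ≤ T * D.card ^ 2 + I0 D A := by
    have e : ∀ x ∈ A, (∑ d ∈ D, ρ d x) ^ 2 = ∑ d ∈ D, ∑ d' ∈ D, ρ d x * ρ d' x := by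
      intro x _; rw [sq, Finset.sum_mul_sum]
    rw [Finset.sum_congr rfl e, Finset.sum_comm]
    have e2 : ∀ d ∈ D, ∑ x ∈ A, ∑ d' ∈ D, ρ d x * ρ d' x ≤ T * D.card + ∑ x ∈ A, ρ d x := by
      intro d hd
      rw [Finset.sum_comm]
      have e3 : ∀ d' ∈ D, ∑ x ∈ A, ρ d x * ρ d' x ≤ T + if d' = d then ∑ x ∈ A, ρ d x else 0 := by
        intro d' hd'
        by_cases h : d' = d
        · subst h
          have : ∀ x ∈ A, ρ d' x * ρ d' x = ρ d' x := by
            intro x _; simp only [hρ]; split_ifs <;> simp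
          rw [Finset.sum_congr rfl this]; simp; linarith [G.one_le]
        · have := G.t2 d (hD hd) d' (hD hd') (Ne.symm h)
          rw [← Finset.sum_boole] at this
          simp only [h, if_false, add_zero]
          refine le_trans (le_of_eq ?_) this
          apply Finset.sum_congr rfl; intro x _
          simp only [hρ]
          by_cases h1 : FF d x = 0 <;> by_cases h2 : FF d' x = 0 <;> simp [h1, h2]
      refine (Finset.sum_le_sum e3).trans ?_
      rw [Finset.sum_add_distrib, Finset.sum_const, Finset.sum_ite_eq' D d, if_pos hd]
      simp only [nsmul_eq_mul]; apply le_of_eq; ring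
    refine (Finset.sum_le_sum e2).trans ?_
    rw [Finset.sum_add_distrib, Finset.sum_const, h1, Finset.sum_comm (s := D)]
    simp only [nsmul_eq_mul]; apply le_of_eq; ring
  rw [h1] at *
  exact h2.trans (by gcongr)

lemma sum_Iq_le {A : Finset V4} {m : ℕ} {T : ℝ} (G : Good A m T) (D : Finset V4) (hD : D ⊆ Dl A) (ρ : ℕ)
    (hρ1 : 1 ≤ ρ) (hρ2 : ρ ^ 2 ≤ A.card) (hρD : ρ ≤ D.card) :
    ∑ q ∈ Finset.Ioc ρ (2*ρ), (Iq D A q : ℝ) ≤ 3 * T * D.card * A.card := by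
  have h1 := sum_Iq G D hD ρ
  have h2 := kst G D hD
  have hT := G.one_le
  set I : ℝ := (I0 D A : ℝ)
  set M : ℝ := (A.card : ℝ)
  set n : ℝ := (D.card : ℝ)
  have r1 : (1:ℝ) ≤ ρ := by exact_mod_cast hρ1
  have r2 : (ρ:ℝ)^2 ≤ M := by simp only [M]; exact_mod_cast hρ2
  have r3 : (ρ:ℝ) ≤ n := by simp only [n]; exact_mod_cast hρD
  have hI : 0 ≤ I := by positivity
  have hM : 0 < M := by nlinarith
  have hn : 0 < n := by linarith
  have key : ρ * I ≤ 2 * T * n * M := by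
    by_contra hc
    push Not at hc
    -- I > 2 T M
    have a1 : 2 * T * M < I := by
      have : ρ * (2 * T * M) < ρ * I := by
        refine lt_of_le_of_lt ?_ hc
        have : 0 ≤ T * M := by positivity
        nlinarith
      exact lt_of_mul_lt_mul_left this (by linarith)
    have a2 : 2 * M ≤ I := by nlinarith
    have a3 : I ^ 2 ≤ 2 * (M * T * n ^ 2) := by nlinarith
    have a4 : (2 * T * n * M)^2 < (ρ * I)^2 := by
      apply pow_lt_pow_left₀ hc (by positivity) two_ne_zero
    have a5 : (ρ * I)^2 ≤ M * (2 * (M * T * n ^ 2)) := by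
      rw [mul_pow]; exact mul_le_mul r2 a3 (by positivity) hM.le
    have a6 : 0 < M^2 * n^2 := by positivity
    have a7 : T * (M^2 * n^2) ≤ T^2 * (M^2 * n^2) := by
      apply mul_le_mul_of_nonneg_right _ a6.le; nlinarith
    have a8 : 0 ≤ T * (M^2 * n^2) := by positivity
    nlinarith
  linarith

lemma sum_inv_class {α γ : Type*} [Fintype γ] [DecidableEq γ] (X : Finset α) (c : α → γ) :
    ∑ x ∈ X, (1:ℝ) / ((X.filter (fun x' => c x' = c x)).card : ℝ) ≤ Fintype.card γ := by
  rw [← Finset.sum_fiberwise_of_maps_to (s := X) (t := Finset.univ) (g := c) (fun _ _ => Finset.mem_univ _)]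
  have : ∀ y ∈ (Finset.univ : Finset γ), ∑ x ∈ X.filter (fun x => c x = y),
      (1:ℝ) / ((X.filter (fun x' => c x' = c x)).card : ℝ) ≤ 1 := by
    intro y _
    have e : ∀ x ∈ X.filter (fun x => c x = y), (1:ℝ) / ((X.filter (fun x' => c x' = c x)).card : ℝ)
        = 1 / ((X.filter (fun x' => c x' = y)).card : ℝ) := by
      intro x hx; rw [(Finset.mem_filter.mp hx).2]
    rw [Finset.sum_congr rfl e, Finset.sum_const, nsmul_eq_mul, mul_one_div]
    exact div_self_le_one _
  refine (Finset.sum_le_sum this).trans ?_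
  simp

def cl (q : ℕ) (x : V4) : Fin 4 → ZMod q := fun i => (x i : ZMod q)

lemma cl_dvd_left {q : ℕ} {d d' x : V4} (h : cl q d' = cl q d) (h0 : FF d' x = 0) : (q:ℤ) ∣ FF d x := by
  rw [← ZMod.intCast_zmod_eq_zero_iff_dvd]
  have h1 : ((FF d' x : ℤ) : ZMod q) = 0 := by rw [h0]; simp
  have h2 : ∀ i, (d' i : ZMod q) = (d i : ZMod q) := fun i => congrFun h i
  unfold FF at h1 ⊢
  push_cast at h1 ⊢
  simpa only [h2] using h1

lemma cl_dvd_right {q : ℕ} {d x x' : V4} (h : cl q x' = cl q x) (h0 : FF d x' = 0) : (q:ℤ) ∣ FF d x := by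
  rw [← ZMod.intCast_zmod_eq_zero_iff_dvd]
  have h1 : ((FF d x' : ℤ) : ZMod q) = 0 := by rw [h0]; simp
  have h2 : ∀ i, (x' i : ZMod q) = (x i : ZMod q) := fun i => congrFun h i
  unfold FF at h1 ⊢
  push_cast at h1 ⊢
  simpa only [h2] using h1

lemma card_cl (q : ℕ) [NeZero q] : (Fintype.card (Fin 4 → ZMod q) : ℝ) = (q:ℝ)^4 := by
  rw [Fintype.card_fun, ZMod.card]; simp

lemma rr_le (A : Finset V4) (d : V4) : rr A d ≤ A.card := Finset.card_filter_le _ _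

lemma stepF1 {A : Finset V4} {m : ℕ} {T : ℝ} (G : Good A m T) (D : Finset V4) (hD : D ⊆ Dl A) (ρ : ℕ)
    (hρ1 : 1 ≤ ρ) (hρ2 : ρ ^ 2 ≤ A.card) (σ : ℝ) (hσ : 0 < σ) (hlo : ∀ d ∈ D, σ ≤ rr A d)
    (hhi : ∀ d ∈ D, (rr A d : ℝ) ≤ 2 * σ) (hb : 6 * T ^ 2 * A.card ≤ ρ * σ ^ 2) :
    σ * D.card ≤ 192 * T * A.card * ρ ^ 3 := by
  classical
  have hT := G.one_le
  have r1 : (1:ℝ) ≤ ρ := by exact_mod_cast hρ1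
  have r2 : (ρ:ℝ)^2 ≤ A.card := by exact_mod_cast hρ2
  have hM : (0:ℝ) < A.card := by nlinarith
  rcases D.eq_empty_or_nonempty with rfl | ⟨d0, hd0⟩
  · simp; positivity
  have hDpos : (0:ℝ) < D.card := by exact_mod_cast Finset.card_pos.mpr ⟨d0, hd0⟩
  have hσM : σ ≤ A.card := (hlo d0 hd0).trans (by exact_mod_cast rr_le A d0)
  by_cases hDρ : D.card < ρ
  · have h1 : (D.card : ℝ) ≤ ρ := by exact_mod_cast hDρ.le
    have h2 : (ρ:ℝ) ≤ ρ^3 := le_self_pow₀ r1 (by norm_num)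
    calc σ * D.card ≤ A.card * ρ := by gcongr
      _ ≤ A.card * ρ^3 := by gcongr
      _ ≤ 192 * T * (A.card * ρ^3) := le_mul_of_one_le_left (by positivity) (by linarith)
      _ = _ := by ring
  push Not at hDρ
  have hsum := sum_Iq_le G D hD ρ hρ1 hρ2 hDρ
  obtain ⟨q, hq, hqle⟩ : ∃ q ∈ Finset.Ioc ρ (2*ρ), (Iq D A q : ℝ) ≤ 3 * T * D.card * A.card / ρ := by
    apply Finset.exists_le_of_sum_le (⟨2*ρ, by simp; omega⟩)
    rw [Finset.sum_const, Nat.card_Ioc]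
    have : 2 * ρ - ρ = ρ := by omega
    rw [this, nsmul_eq_mul, mul_div_cancel₀ _ (by positivity)]
    exact hsum
  obtain ⟨hq1, hq2⟩ := Finset.mem_Ioc.mp hq
  have : NeZero q := ⟨by omega⟩
  have hq2' : (q:ℝ) ≤ 2 * ρ := by exact_mod_cast hq2
  have hF : ∀ d x, x ∈ A → x - d ∈ A → FF d x = 0 := fun d x hx hxd =>
    FF_eq_zero (G.sph x hx) (G.sph _ hxd)
  have cs := class_cs D A (fun d x => x - d ∈ A) (cl q)
    ((D ×ˢ A).filter (fun p => (q:ℤ) ∣ FF p.1 p.2))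
    (fun d hd x hx d' _ hc hR => Finset.mem_filter.mpr ⟨Finset.mem_product.mpr ⟨hd, hx⟩,
      cl_dvd_left hc (hF d' x hx hR)⟩)
  have hdeg : σ * D.card ≤ ∑ d ∈ D, ((A.filter (fun x => x - d ∈ A)).card : ℝ) := by
    calc σ * D.card = ∑ d ∈ D, σ := by rw [Finset.sum_const, nsmul_eq_mul]; ring
      _ ≤ _ := Finset.sum_le_sum hlo
  have hS2 : ∑ x ∈ D, ∑ x' ∈ D.filter (fun x' => cl q x' = cl q x),
        ((A.filter (fun y => y - x ∈ A ∧ y - x' ∈ A)).card : ℝ) /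
          ((D.filter (fun x' => cl q x' = cl q x)).card : ℝ) ≤ 32 * σ * ρ^4 + T * D.card := by
    have e : ∀ x ∈ D, ∑ x' ∈ D.filter (fun x' => cl q x' = cl q x),
        ((A.filter (fun y => y - x ∈ A ∧ y - x' ∈ A)).card : ℝ) /
          ((D.filter (fun x' => cl q x' = cl q x)).card : ℝ) ≤
          2 * σ * (1 / ((D.filter (fun x' => cl q x' = cl q x)).card : ℝ)) + T := by
      intro x hx
      have hn : (0:ℝ) < ((D.filter (fun x' => cl q x' = cl q x)).card : ℝ) := by
        exact_mod_cast Finset.card_pos.mpr ⟨x, by simp [hx]⟩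
      have e1 : ∀ x' ∈ D.filter (fun x' => cl q x' = cl q x),
          ((A.filter (fun y => y - x ∈ A ∧ y - x' ∈ A)).card : ℝ) ≤ (if x' = x then 2 * σ else 0) + T := by
        intro x' hx'
        by_cases h : x' = x
        · subst h
          simp only [and_self, if_true]
          have := hhi x' hx
          rw [rr] at this
          linarith
        · simp only [h, if_false, zero_add]
          refine le_trans ?_ (G.t2 x (hD hx) x' (hD (Finset.mem_filter.mp hx').1) (Ne.symm h))
          norm_cast
          apply Finset.card_le_card
          intro y hy
          obtain ⟨hy, h1, h2⟩ := Finset.mem_filter.mp hy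
          exact Finset.mem_filter.mpr ⟨hy, hF _ _ hy h1, hF _ _ hy h2⟩
      rw [← Finset.sum_div, div_le_iff₀ hn]
      refine (Finset.sum_le_sum e1).trans ?_
      rw [Finset.sum_add_distrib, Finset.sum_ite_eq', if_pos (by simp [hx]), Finset.sum_const, nsmul_eq_mul]
      apply le_of_eq; field_simp
    refine (Finset.sum_le_sum e).trans ?_
    rw [Finset.sum_add_distrib, ← Finset.mul_sum, Finset.sum_const, nsmul_eq_mul]
    have h5 := sum_inv_class D (cl q)
    rw [card_cl] at h5
    have h6 : (q:ℝ)^4 ≤ (2 * ρ)^4 := by gcongr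
    have h7 : ∑ x ∈ D, (1:ℝ) / ((D.filter (fun x' => cl q x' = cl q x)).card : ℝ) ≤ 16 * ρ^4 := by
      refine h5.trans (h6.trans (le_of_eq ?_)); ring
    have h8 := mul_le_mul_of_nonneg_left h7 (by positivity : 0 ≤ 2 * σ)
    linarith
  have fin : (σ * D.card)^2 ≤ (3 * T * D.card * A.card / ρ) * (32 * σ * ρ^4 + T * D.card) := by
    calc (σ * D.card)^2 ≤ (∑ d ∈ D, ((A.filter (fun x => x - d ∈ A)).card : ℝ))^2 := by gcongr
      _ ≤ (Iq D A q : ℝ) * _ := cs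
      _ ≤ _ := by gcongr
  set M : ℝ := (A.card : ℝ)
  set n : ℝ := (D.card : ℝ)
  have hρ0 : (0:ℝ) < ρ := by linarith
  have e1 : (3 * T * n * M / ρ) * (32 * σ * ρ^4 + T * n) = 96 * T * n * M * σ * ρ^3 + (3 * T^2 * M / ρ) * n^2 := by
    field_simp; ring
  have e2 : 3 * T^2 * M / ρ ≤ σ^2 / 2 := by
    rw [div_le_iff₀ hρ0]; linarith
  rw [e1] at fin
  have e3 : (3 * T^2 * M / ρ) * n^2 ≤ (σ^2/2) * n^2 := by gcongr
  have e4 : (σ * n) * (σ * n) ≤ (192 * T * M * ρ^3) * (σ * n) := by nlinarith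
  exact le_of_mul_le_mul_right e4 (by positivity)

def Hq (A : Finset V4) (σ0 : ℝ) (q : ℕ) : ℝ :=
  ∑ z ∈ A, ∑ z' ∈ A, if (cl q z' = cl q z ∧ z' ≠ z ∧ σ0 < rr A (z - z')) then (rr A (z - z') : ℝ) else 0

lemma mem_Dl {A : Finset V4} {z z' : V4} (hz : z ∈ A) (hz' : z' ∈ A) (h : z' ≠ z) : z - z' ∈ Dl A := by
  refine Finset.mem_erase.mpr ⟨sub_ne_zero.mpr (Ne.symm h), Finset.mem_image.mpr ⟨(z, z'), by simp [hz, hz'], rfl⟩⟩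

lemma sum_Hq {A : Finset V4} {m : ℕ} {T : ℝ} (G : Good A m T) (σ0 : ℝ) (ρ : ℕ) (hρ1 : 1 ≤ ρ) :
    ∑ q ∈ Finset.Ioc ρ (2*ρ), Hq A σ0 q ≤
      T * ∑ d ∈ (Dl A).filter (fun d => σ0 < rr A d), (rr A d : ℝ)^2 := by
  classical
  have hT := G.one_le
  -- swap
  have h1 : ∑ q ∈ Finset.Ioc ρ (2*ρ), Hq A σ0 q ≤ ∑ z ∈ A, ∑ z' ∈ A,
      T * (if (z' ≠ z ∧ σ0 < rr A (z - z')) then (rr A (z - z') : ℝ) else 0) := by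
    unfold Hq
    rw [Finset.sum_comm]
    apply Finset.sum_le_sum; intro z hz
    rw [Finset.sum_comm]
    apply Finset.sum_le_sum; intro z' hz'
    by_cases h : z' ≠ z ∧ σ0 < rr A (z - z')
    · rw [if_pos h]
      have hd := mem_Dl hz hz' h.1
      obtain ⟨i, hi⟩ : ∃ i, (z - z') i ≠ 0 := by
        by_contra hc; push Not at hc
        exact h.1 (sub_eq_zero.mp (funext hc)).symm
      have hb : ((z - z') i).natAbs ≤ 9 * m := by
        have h2 := Dl_norm G.sph hd
        have h3 : (z - z') i ^ 2 ≤ 4 * (m:ℤ) :=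
          (Finset.single_le_sum (f := fun i => (z - z') i ^ 2) (fun _ _ => sq_nonneg _) (Finset.mem_univ i)).trans h2
        have h4 : |(z - z') i| ≤ 4 * (m:ℤ) := by
          have h5 := Int.one_le_abs hi
          have h6 := sq_abs ((z - z') i)
          nlinarith
        rw [Int.abs_eq_natAbs] at h4
        omega
      have h5 := G.t1 _ (Int.natAbs_ne_zero.mpr hi) hb
      have h6 := card_Ioc_dvd _ hi ρ
      have h7 : ∀ q ∈ Finset.Ioc ρ (2*ρ), (if (cl q z' = cl q z ∧ z' ≠ z ∧ σ0 < rr A (z - z'))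
          then (rr A (z - z') : ℝ) else 0) ≤ (if (q:ℤ) ∣ (z - z') i then 1 else 0) * (rr A (z - z') : ℝ) := by
        intro q _
        by_cases hc : cl q z' = cl q z
        · have : (q:ℤ) ∣ (z - z') i := by
            rw [← ZMod.intCast_zmod_eq_zero_iff_dvd]
            have := congrFun hc i
            simp only [cl] at this
            simp only [Pi.sub_apply]; push_cast; rw [this]; ring
          rw [if_pos ⟨hc, h⟩, if_pos this, one_mul]
        · rw [if_neg (fun h' => hc h'.1)]
          positivity
      refine (Finset.sum_le_sum h7).trans ?_
      rw [← Finset.sum_mul, Finset.sum_boole]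
      apply mul_le_mul_of_nonneg_right _ (by positivity)
      exact le_trans (by exact_mod_cast h6) h5
    · rw [if_neg h, mul_zero]
      apply le_of_eq
      apply Finset.sum_eq_zero
      intro q _
      exact if_neg (fun h' => h h'.2)
  refine h1.trans ?_
  simp only [← Finset.mul_sum]
  apply mul_le_mul_of_nonneg_left _ (by linarith)
  rw [← Finset.sum_product' (f := fun z z' => if (z' ≠ z ∧ σ0 < rr A (z - z')) then (rr A (z - z') : ℝ) else 0),
    ← Finset.sum_filter]
  rw [← Finset.sum_fiberwise_of_maps_to (t := (Dl A).filter (fun d => σ0 < rr A d)) (g := fun p : V4 × V4 => p.1 - p.2)]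
  · apply Finset.sum_le_sum
    intro d hd
    have e : ∀ p ∈ ((A ×ˢ A).filter (fun p => p.2 ≠ p.1 ∧ σ0 < (rr A (p.1 - p.2) : ℝ))).filter (fun p => p.1 - p.2 = d),
        (rr A (p.1 - p.2) : ℝ) = rr A d := by
      intro p hp; rw [(Finset.mem_filter.mp hp).2]
    rw [Finset.sum_congr rfl e, Finset.sum_const, nsmul_eq_mul, sq]
    apply mul_le_mul_of_nonneg_right _ (by positivity)
    norm_cast
    rw [rr]
    apply Finset.card_le_card_of_injOn Prod.fst
    · intro p hp
      obtain ⟨hp, hpd⟩ := Finset.mem_filter.mp hp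
      obtain ⟨hp, _⟩ := Finset.mem_filter.mp hp
      obtain ⟨ha, hb⟩ := Finset.mem_product.mp hp
      refine Finset.mem_filter.mpr ⟨ha, ?_⟩
      rw [← hpd]; simpa using hb
    · intro p hp p' hp' h
      have h1 := (Finset.mem_filter.mp hp).2
      have h2 := (Finset.mem_filter.mp hp').2
      refine Prod.ext h ?_
      have : p.1 - p.2 = p'.1 - p'.2 := h1.trans h2.symm
      rw [h] at this
      exact sub_right_injective this
  · intro p hp
    obtain ⟨hp, h1, h2⟩ := Finset.mem_filter.mp hp
    obtain ⟨ha, hb⟩ := Finset.mem_product.mp hp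
    exact Finset.mem_filter.mpr ⟨mem_Dl ha hb h1, h2⟩

lemma exists_two {s : Finset ℕ} (hs : s.Nonempty) (f g : ℕ → ℝ) (a b : ℝ) (ha : 0 < a) (hb : 0 < b)
    (hf : ∑ q ∈ s, f q ≤ a) (hg : ∑ q ∈ s, g q ≤ b) (hf0 : ∀ q ∈ s, 0 ≤ f q) (hg0 : ∀ q ∈ s, 0 ≤ g q) :
    ∃ q ∈ s, f q ≤ 2 * a / s.card ∧ g q ≤ 2 * b / s.card := by
  have hc : (0:ℝ) < s.card := by exact_mod_cast Finset.card_pos.mpr hs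
  obtain ⟨q, hq, h⟩ : ∃ q ∈ s, f q / a + g q / b ≤ 2 / s.card := by
    apply Finset.exists_le_of_sum_le hs
    rw [Finset.sum_const, nsmul_eq_mul, mul_div_cancel₀ _ hc.ne', Finset.sum_add_distrib,
      ← Finset.sum_div, ← Finset.sum_div]
    have h1 : (∑ q ∈ s, f q) / a ≤ 1 := (div_le_one ha).mpr hf
    have h2 : (∑ q ∈ s, g q) / b ≤ 1 := (div_le_one hb).mpr hg
    linarith
  refine ⟨q, hq, ?_, ?_⟩
  · have : f q / a ≤ 2 / s.card := by
      have := div_nonneg (hg0 q hq) hb.le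
      linarith
    rw [div_le_iff₀ ha] at this
    calc f q ≤ _ := this
      _ = _ := by ring
  · have : g q / b ≤ 2 / s.card := by
      have := div_nonneg (hf0 q hq) ha.le
      linarith
    rw [div_le_iff₀ hb] at this
    calc g q ≤ _ := this
      _ = _ := by ring

lemma sum_deg (A N : Finset V4) : ∑ z ∈ A, ((N.filter (fun ν => z - ν ∈ A)).card : ℝ) = ∑ ν ∈ N, (rr A ν : ℝ) := by
  classical
  have e : ∀ z ∈ A, ((N.filter (fun ν => z - ν ∈ A)).card : ℝ) = ∑ ν ∈ N, if z - ν ∈ A then (1:ℝ) else 0 := by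
    intro z _; rw [Finset.sum_boole]
  rw [Finset.sum_congr rfl e, Finset.sum_comm]
  apply Finset.sum_congr rfl; intro ν _
  rw [Finset.sum_boole]; rfl

lemma deg_le (A N : Finset V4) (z : V4) : (N.filter (fun ν => z - ν ∈ A)).card ≤ A.card := by
  apply Finset.card_le_card_of_injOn (fun ν => z - ν)
  · intro ν hν; exact (Finset.mem_filter.mp hν).2
  · intro a _ b _ h; exact sub_right_injective h

lemma codeg_le (A N : Finset V4) (z z' : V4) :
    (N.filter (fun ν => z - ν ∈ A ∧ z' - ν ∈ A)).card ≤ rr A (z - z') := by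
  apply Finset.card_le_card_of_injOn (fun ν => z - ν)
  · intro ν hν
    obtain ⟨_, h1, h2⟩ := Finset.mem_filter.mp hν
    refine Finset.mem_filter.mpr ⟨h1, ?_⟩
    have : z - ν - (z - z') = z' - ν := by abel
    rw [this]; exact h2
  · intro a _ b _ h; exact sub_right_injective h

set_option maxHeartbeats 2000000 in
lemma stepMain {A : Finset V4} {m : ℕ} {T : ℝ} (G : Good A m T) (N : Finset V4) (hN : N ⊆ Dl A) (ρ : ℕ)
    (hρ1 : 1 ≤ ρ) (hρ2 : ρ ^ 2 ≤ A.card) (hρN : ρ ≤ N.card) (τ : ℝ) (hτ : 0 < τ)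
    (hlo : ∀ d ∈ N, τ ≤ rr A d) (hhi : ∀ d ∈ N, (rr A d : ℝ) ≤ 2 * τ)
    (θ σ0 H : ℝ) (hθ : 0 < θ) (hθ2 : θ * (A.card:ℝ)^2 ≤ N.card * τ / 2) (hσ0 : 0 < σ0) (hH : 0 < H)
    (hHs : ∑ d ∈ (Dl A).filter (fun d => σ0 < rr A d), (rr A d : ℝ)^2 ≤ H) :
    N.card * τ^2 / 4 ≤ 192 * T * ρ^3 * τ * N.card / θ + 6 * T * σ0 * (A.card:ℝ)^2 / ρ
      + 192 * T^2 * ρ^2 * H / θ := by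
  classical
  have hT := G.one_le
  have r1 : (1:ℝ) ≤ ρ := by exact_mod_cast hρ1
  have r2 : (ρ:ℝ)^2 ≤ A.card := by exact_mod_cast hρ2
  have r3 : (ρ:ℝ) ≤ N.card := by exact_mod_cast hρN
  have hM : (0:ℝ) < A.card := by nlinarith
  have hn : (0:ℝ) < N.card := by linarith
  have hI := sum_Iq_le G N hN ρ hρ1 hρ2 hρN
  have hHq := (sum_Hq G σ0 ρ hρ1).trans (mul_le_mul_of_nonneg_left hHs (by linarith))
  have hcard : (Finset.Ioc ρ (2*ρ)).card = ρ := by rw [Nat.card_Ioc]; omega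
  obtain ⟨q, hq, hqa, hqb⟩ := exists_two (s := Finset.Ioc ρ (2*ρ)) ⟨2*ρ, by simp; omega⟩
    (fun q => (Iq N A q : ℝ)) (fun q => Hq A σ0 q) _ _ (by positivity) (by positivity) hI hHq
    (fun _ _ => Nat.cast_nonneg _)
    (fun q _ => Finset.sum_nonneg (fun z _ => Finset.sum_nonneg (fun z' _ => by split_ifs <;> positivity)))
  rw [hcard] at hqa hqb
  obtain ⟨hq1, hq2⟩ := Finset.mem_Ioc.mp hq
  have : NeZero q := ⟨by omega⟩
  have hq2' : (q:ℝ) ≤ 2 * ρ := by exact_mod_cast hq2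
  have hq0 : (0:ℝ) < q := by exact_mod_cast (by omega : 0 < q)
  have hF : ∀ d x, x ∈ A → x - d ∈ A → FF d x = 0 := fun d x hx hxd =>
    FF_eq_zero (G.sph x hx) (G.sph _ hxd)
  set M : ℝ := (A.card : ℝ) with hMdef
  set n : V4 → ℝ := fun z => ((A.filter (fun x' => cl q x' = cl q z)).card : ℝ) with hndef
  set K : ℝ := 16 * ρ^4 / (θ * M) with hK
  have hKpos : 0 < K := by positivity
  set A' := A.filter (fun z => θ * M / (q:ℝ)^4 ≤ n z) with hA'
  have npos : ∀ z ∈ A, 0 < n z := by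
    intro x hx
    simp only [hndef]
    exact_mod_cast Finset.card_pos.mpr ⟨x, by simp [hx]⟩
  have hq4 : (q:ℝ)^4 ≤ 16 * ρ^4 := by
    calc (q:ℝ)^4 ≤ (2*ρ)^4 := by gcongr
      _ = _ := by ring
  have hninv : ∀ z ∈ A', 1 / n z ≤ K := by
    intro z hz
    obtain ⟨hz, hz2⟩ := Finset.mem_filter.mp hz
    have h1 : 0 < θ * M / (q:ℝ)^4 := by positivity
    calc 1 / n z ≤ 1 / (θ * M / (q:ℝ)^4) := one_div_le_one_div_of_le h1 hz2
      _ = (q:ℝ)^4 / (θ * M) := by rw [one_div_div]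
      _ ≤ K := by rw [hK]; gcongr
  have hclass : ∀ z ∈ A', A'.filter (fun x' => cl q x' = cl q z) = A.filter (fun x' => cl q x' = cl q z) := by
    intro z hz
    ext x
    simp only [Finset.mem_filter, hA']
    constructor
    · rintro ⟨⟨h1, _⟩, h2⟩; exact ⟨h1, h2⟩
    · rintro ⟨h1, h2⟩
      refine ⟨⟨h1, ?_⟩, h2⟩
      have : n x = n z := by simp only [hndef, h2]
      rw [this]; exact (Finset.mem_filter.mp hz).2
  have cs := class_cs A' N (fun z ν => z - ν ∈ A) (cl q)
    (((N ×ˢ A).filter (fun p => (q:ℤ) ∣ FF p.1 p.2)).map (Equiv.prodComm V4 V4).toEmbedding)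
    (fun z hz ν hν z' hz' hc hR => by
      rw [Finset.mem_map_equiv]
      exact Finset.mem_filter.mpr ⟨Finset.mem_product.mpr ⟨hν, (Finset.mem_filter.mp hz).1⟩,
        cl_dvd_right hc (hF ν z' (Finset.mem_filter.mp hz').1 hR)⟩)
  rw [Finset.card_map] at cs
  -- lower bound of degree sum
  set dg : V4 → ℝ := fun z => ((N.filter (fun ν => z - ν ∈ A)).card : ℝ) with hdg
  have hdeg_all : N.card * τ ≤ ∑ z ∈ A, dg z := by
    rw [hdg, sum_deg]
    calc N.card * τ = ∑ ν ∈ N, τ := by rw [Finset.sum_const, nsmul_eq_mul]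
      _ ≤ _ := Finset.sum_le_sum hlo
  have hdeg_up : ∑ z ∈ A, dg z ≤ 2 * τ * N.card := by
    rw [hdg, sum_deg]
    calc _ ≤ ∑ ν ∈ N, 2 * τ := Finset.sum_le_sum hhi
      _ = _ := by rw [Finset.sum_const, nsmul_eq_mul]; ring
  have hsplit : ∑ z ∈ A', dg z + ∑ z ∈ A.filter (fun z => ¬ (θ * M / (q:ℝ)^4 ≤ n z)), dg z = ∑ z ∈ A, dg z :=
    Finset.sum_filter_add_sum_filter_not A _ _
  have hdrop : ∑ z ∈ A.filter (fun z => ¬ (θ * M / (q:ℝ)^4 ≤ n z)), dg z ≤ θ * M^2 := by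
    have h1 : ∀ z ∈ A.filter (fun z => ¬ (θ * M / (q:ℝ)^4 ≤ n z)), dg z ≤ (θ * M / (q:ℝ)^4 * M) * (1 / n z) := by
      intro z hz
      obtain ⟨hz, hz2⟩ := Finset.mem_filter.mp hz
      push Not at hz2
      have h2 : dg z ≤ M := by simp only [hdg, hMdef]; exact_mod_cast deg_le A N z
      have h3 := npos z hz
      rw [mul_one_div, le_div_iff₀ h3]
      calc dg z * n z ≤ M * (θ * M / (q:ℝ)^4) := by gcongr
        _ = _ := by ring
    calc _ ≤ ∑ z ∈ A.filter (fun z => ¬ (θ * M / (q:ℝ)^4 ≤ n z)), (θ * M / (q:ℝ)^4 * M) * (1 / n z) :=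
          Finset.sum_le_sum h1
      _ ≤ ∑ z ∈ A, (θ * M / (q:ℝ)^4 * M) * (1 / n z) := by
          apply Finset.sum_le_sum_of_subset_of_nonneg (Finset.filter_subset _ _)
          intro z hz _
          have := npos z hz
          positivity
      _ ≤ (θ * M / (q:ℝ)^4 * M) * (q:ℝ)^4 := by
          rw [← Finset.mul_sum]
          have h5 := sum_inv_class A (cl q)
          rw [card_cl] at h5
          gcongr
      _ = θ * M^2 := by field_simp
  have hdegA' : N.card * τ / 2 ≤ ∑ z ∈ A', dg z := by linarith
  -- upper bound of second moment
  have hS2 : ∑ x ∈ A', ∑ x' ∈ A'.filter (fun x' => cl q x' = cl q x),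
        ((N.filter (fun y => x - y ∈ A ∧ x' - y ∈ A)).card : ℝ) /
          ((A'.filter (fun x' => cl q x' = cl q x)).card : ℝ)
        ≤ K * (2 * τ * N.card) + σ0 * M + K * Hq A σ0 q := by
    have e : ∀ x ∈ A', ∑ x' ∈ A'.filter (fun x' => cl q x' = cl q x),
        ((N.filter (fun y => x - y ∈ A ∧ x' - y ∈ A)).card : ℝ) /
          ((A'.filter (fun x' => cl q x' = cl q x)).card : ℝ) ≤
        K * dg x + σ0 + K * ∑ z' ∈ A, (if (cl q z' = cl q x ∧ z' ≠ x ∧ σ0 < rr A (x - z')) then (rr A (x - z') : ℝ) else 0) := by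
      intro x hx
      rw [hclass x hx]
      have hxA := (Finset.mem_filter.mp hx).1
      have hnx := npos x hxA
      have e1 : ∀ x' ∈ A.filter (fun x' => cl q x' = cl q x),
          ((N.filter (fun y => x - y ∈ A ∧ x' - y ∈ A)).card : ℝ) / n x ≤
          (if x' = x then K * dg x else 0) + σ0 / n x +
          K * (if (cl q x' = cl q x ∧ x' ≠ x ∧ σ0 < rr A (x - x')) then (rr A (x - x') : ℝ) else 0) := by
        intro x' hx'
        have hc := (Finset.mem_filter.mp hx').2
        have hσn : 0 ≤ σ0 / n x := by positivity
        have hinv := hninv x hx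
        by_cases h : x' = x
        · subst h
          simp only [and_self, if_true, ne_eq, not_true_eq_false, false_and, and_false, if_false, mul_zero, add_zero]
          have : ((N.filter (fun y => x' - y ∈ A)).card : ℝ) / n x' ≤ K * dg x' := by
            rw [div_eq_mul_one_div, mul_comm]
            exact mul_le_mul_of_nonneg_right hinv (by positivity)
          linarith
        · have hcd : ((N.filter (fun y => x - y ∈ A ∧ x' - y ∈ A)).card : ℝ) ≤ rr A (x - x') := by
            exact_mod_cast codeg_le A N x x'
          by_cases h2 : σ0 < rr A (x - x')
          · rw [if_neg h, if_pos ⟨hc, h, h2⟩]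
            have : ((N.filter (fun y => x - y ∈ A ∧ x' - y ∈ A)).card : ℝ) / n x ≤ K * rr A (x - x') := by
              rw [div_eq_mul_one_div, mul_comm]
              exact mul_le_mul hinv hcd (by positivity) hKpos.le
            linarith
          · rw [if_neg h, if_neg (fun h' => h2 h'.2.2)]
            push Not at h2
            have : ((N.filter (fun y => x - y ∈ A ∧ x' - y ∈ A)).card : ℝ) / n x ≤ σ0 / n x := by
              have := hcd.trans h2
              gcongr
            linarith
      refine (Finset.sum_le_sum e1).trans ?_
      rw [Finset.sum_add_distrib, Finset.sum_add_distrib, Finset.sum_ite_eq', if_pos (by simp [hxA]),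
        Finset.sum_const, nsmul_eq_mul, ← Finset.mul_sum]
      have h3 : ((A.filter (fun x' => cl q x' = cl q x)).card : ℝ) * (σ0 / n x) = σ0 := by
        change n x * (σ0 / n x) = σ0
        field_simp
      rw [h3]
      have h4 := mul_le_mul_of_nonneg_left (Finset.sum_le_sum_of_subset_of_nonneg (f := fun x' => (if (cl q x' = cl q x ∧ x' ≠ x ∧ σ0 < rr A (x - x')) then (rr A (x - x') : ℝ) else 0)) (Finset.filter_subset (fun x' => cl q x' = cl q x) A) (fun _ _ _ => by split_ifs <;> positivity)) hKpos.le
      linarith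
    refine (Finset.sum_le_sum e).trans ?_
    rw [Finset.sum_add_distrib, Finset.sum_add_distrib, ← Finset.mul_sum, ← Finset.mul_sum, Finset.sum_const, nsmul_eq_mul]
    have hsub : A' ⊆ A := Finset.filter_subset _ _
    have b1 : ∑ z ∈ A', dg z ≤ 2 * τ * N.card :=
      (Finset.sum_le_sum_of_subset_of_nonneg hsub (fun _ _ _ => by positivity)).trans hdeg_up
    have b2 : (A'.card : ℝ) ≤ M := by rw [hMdef]; exact_mod_cast Finset.card_le_card hsub
    have b3 : ∑ z ∈ A', ∑ z' ∈ A, (if (cl q z' = cl q z ∧ z' ≠ z ∧ σ0 < rr A (z - z')) then (rr A (z - z') : ℝ) else 0)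
        ≤ Hq A σ0 q := by
      apply Finset.sum_le_sum_of_subset_of_nonneg hsub
      intro z _ _
      apply Finset.sum_nonneg
      intro z' _; split_ifs <;> positivity
    have c1 := mul_le_mul_of_nonneg_left b1 hKpos.le
    have c2 := mul_le_mul_of_nonneg_right b2 hσ0.le
    have c3 := mul_le_mul_of_nonneg_left b3 hKpos.le
    linarith
  have hS3 : K * (2 * τ * N.card) + σ0 * M + K * Hq A σ0 q ≤ K * (2 * τ * N.card) + σ0 * M + K * (2 * (T * H) / ρ) := by
    gcongr
  have hρ0 : (0:ℝ) < ρ := by linarith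
  have fin : (N.card * τ / 2)^2 ≤ (2 * (3 * T * N.card * M) / ρ) * (K * (2 * τ * N.card) + σ0 * M + K * (2 * (T * H) / ρ)) := by
    calc (N.card * τ / 2)^2 ≤ (∑ z ∈ A', dg z)^2 := pow_le_pow_left₀ (by positivity) hdegA' 2
      _ ≤ (Iq N A q : ℝ) * _ := cs
      _ ≤ _ := by
        have h9 := hS2.trans hS3
        apply mul_le_mul hqa h9 _ (by positivity)
        apply Finset.sum_nonneg; intro i _; apply Finset.sum_nonneg; intro j _; exact div_nonneg (Nat.cast_nonneg _) (Nat.cast_nonneg _)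
  have e1 : (2 * (3 * T * N.card * M) / ρ) * (K * (2 * τ * N.card) + σ0 * M + K * (2 * (T * H) / ρ))
      = N.card * (192 * T * ρ^3 * τ * N.card / θ + 6 * T * σ0 * M^2 / ρ + 192 * T^2 * ρ^2 * H / θ) := by
    rw [hK]; field_simp; ring
  rw [e1] at fin
  have e2 : ((N.card : ℝ) * τ / 2)^2 = N.card * (N.card * τ^2 / 4) := by ring
  rw [e2] at fin
  exact le_of_mul_le_mul_left fin hn

lemma sum_rr_le (A : Finset V4) (S : Finset V4) : ∑ d ∈ S, rr A d ≤ A.card ^ 2 := by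
  classical
  have h1 : ∀ d, rr A d ≤ ((A ×ˢ A).filter (fun p => p.1 - p.2 = d)).card := by
    intro d
    unfold rr
    apply Finset.card_le_card_of_injOn (fun x => (x, x - d))
    · intro x hx
      have hx := Finset.mem_filter.mp hx
      simp [hx.1, hx.2]
    · intro x _ y _ h
      exact (Prod.mk.inj h).1
  calc ∑ d ∈ S, rr A d ≤ ∑ d ∈ S, ((A ×ˢ A).filter (fun p => p.1 - p.2 = d)).card :=
        Finset.sum_le_sum (fun d _ => h1 d)
    _ ≤ (A ×ˢ A).card := by
        rw [Finset.sum_card_fiberwise_eq_card_filter]; exact Finset.card_filter_le _ _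
    _ = A.card ^ 2 := by rw [Finset.card_product]; ring

lemma dyadic {A : Finset V4} {m : ℕ} {T : ℝ} (G : Good A m T) (S : Finset V4)
    (hpos : 0 < ∑ d ∈ S, (rr A d : ℝ)^2) :
    ∃ τ : ℝ, 1 ≤ τ ∧ (S.filter (fun d => τ ≤ rr A d ∧ (rr A d : ℝ) ≤ 2 * τ)).Nonempty ∧
      ∑ d ∈ S, (rr A d : ℝ)^2 ≤
        4 * T * (τ^2 * ((S.filter (fun d => τ ≤ rr A d ∧ (rr A d : ℝ) ≤ 2 * τ)).card : ℝ)) := by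
  classical
  have hT := G.one_le
  have key : ∃ j : ℕ, ∑ d ∈ S, (rr A d : ℝ)^2 ≤ 4 * T * (((2:ℝ)^j)^2 *
      ((S.filter (fun d => (2:ℝ)^j ≤ rr A d ∧ (rr A d : ℝ) ≤ 2 * (2:ℝ)^j)).card : ℝ)) := by
    by_contra hc
    push Not at hc
    set X := ∑ d ∈ S, (rr A d : ℝ)^2 with hX
    have h1 : ∀ d ∈ S, (rr A d : ℝ)^2 ≤ ∑ j ∈ Finset.range (Nat.log 2 A.card + 1),
        if ((2:ℝ)^j ≤ rr A d ∧ (rr A d : ℝ) ≤ 2 * (2:ℝ)^j) then 4 * ((2:ℝ)^j)^2 else 0 := by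
      intro d _
      rcases Nat.eq_zero_or_pos (rr A d) with h0 | h0
      · rw [h0]; simp
        apply Finset.sum_nonneg; intro j _; split_ifs <;> positivity
      · have hj : Nat.log 2 (rr A d) ∈ Finset.range (Nat.log 2 A.card + 1) := by
          rw [Finset.mem_range]
          exact Nat.lt_succ_of_le (Nat.log_mono_right (rr_le A d))
        refine le_trans ?_ (Finset.single_le_sum (f := fun j => if ((2:ℝ)^j ≤ rr A d ∧ (rr A d : ℝ) ≤ 2 * (2:ℝ)^j) then 4 * ((2:ℝ)^j)^2 else 0)
          (fun j _ => by split_ifs <;> positivity) hj)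
        have a1 : (2:ℝ)^(Nat.log 2 (rr A d)) ≤ rr A d := by
          exact_mod_cast Nat.pow_log_le_self 2 h0.ne'
        have a2 : (rr A d : ℝ) ≤ 2 * (2:ℝ)^(Nat.log 2 (rr A d)) := by
          have := (Nat.lt_pow_succ_log_self (b := 2) (by norm_num) (rr A d)).le
          rw [Nat.pow_succ, mul_comm] at this
          exact_mod_cast this
        simp only [if_pos (And.intro a1 a2)]
        calc (rr A d : ℝ)^2 ≤ (2 * (2:ℝ)^(Nat.log 2 (rr A d)))^2 := pow_le_pow_left₀ (by positivity) a2 2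
          _ = _ := by ring
    have h2 : X ≤ ∑ j ∈ Finset.range (Nat.log 2 A.card + 1), 4 * (((2:ℝ)^j)^2 *
      ((S.filter (fun d => (2:ℝ)^j ≤ rr A d ∧ (rr A d : ℝ) ≤ 2 * (2:ℝ)^j)).card : ℝ)) := by
      refine (Finset.sum_le_sum h1).trans (le_of_eq ?_)
      rw [Finset.sum_comm]
      apply Finset.sum_congr rfl
      intro j _
      rw [← Finset.sum_filter, Finset.sum_const, nsmul_eq_mul]; ring
    have h3 : T * X ≤ T * ∑ j ∈ Finset.range (Nat.log 2 A.card + 1), 4 * (((2:ℝ)^j)^2 *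
      ((S.filter (fun d => (2:ℝ)^j ≤ rr A d ∧ (rr A d : ℝ) ≤ 2 * (2:ℝ)^j)).card : ℝ)) :=
      mul_le_mul_of_nonneg_left h2 (by linarith)
    rw [Finset.mul_sum (Finset.range _)] at h3
    have h4 : ∑ j ∈ Finset.range (Nat.log 2 A.card + 1), T * (4 * (((2:ℝ)^j)^2 *
      ((S.filter (fun d => (2:ℝ)^j ≤ rr A d ∧ (rr A d : ℝ) ≤ 2 * (2:ℝ)^j)).card : ℝ)))
      < ∑ j ∈ Finset.range (Nat.log 2 A.card + 1), X := by
      apply Finset.sum_lt_sum_of_nonempty (by simp)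
      intro j _
      have := hc j
      linarith
    rw [Finset.sum_const, Finset.card_range, nsmul_eq_mul] at h4
    have h5 := G.t3
    push_cast at h4
    nlinarith
  obtain ⟨j, hj⟩ := key
  refine ⟨(2:ℝ)^j, one_le_pow₀ (by norm_num), ?_, hj⟩
  by_contra hne
  rw [Finset.not_nonempty_iff_eq_empty] at hne
  rw [hne] at hj
  simp at hj
  linarith

lemma F1log {A : Finset V4} {m : ℕ} {T : ℝ} (G : Good A m T) (hT7 : 10^7 ≤ T) (hTM : T^10000 ≤ A.card)
    (D : Finset V4) (hD : D ⊆ Dl A) (hne : D.Nonempty) (σ : ℝ) (hσ : 0 < σ) (hlo : ∀ d ∈ D, σ ≤ rr A d)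
    (hhi : ∀ d ∈ D, (rr A d : ℝ) ≤ 2 * σ) (hσL : 0.3 * Real.log A.card ≤ Real.log σ) :
    7 * Real.log σ + Real.log D.card ≤ 8 * Real.log T + 4 * Real.log A.card ∨
    Real.log σ + Real.log D.card ≤ 2 * Real.log T + Real.log A.card := by
  have hT0 : 0 < T := by linarith
  have hDpos : (0:ℝ) < D.card := by exact_mod_cast Finset.card_pos.mpr hne
  have hM : (0:ℝ) < A.card := lt_of_lt_of_le (by positivity) hTM
  set M : ℝ := (A.card : ℝ) with hMdef
  have hL : 10000 * Real.log T ≤ Real.log M := by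
    have := Real.log_le_log (by positivity) hTM
    rw [Real.log_pow] at this; exact_mod_cast this
  have h7 : Real.log (10^7) ≤ Real.log T := Real.log_le_log (by norm_num) hT7
  have hl0 : 0 < Real.log T := Real.log_pos (by linarith)
  have h10 : ∀ c : ℝ, 0 < c → c ≤ 10^7 → Real.log c ≤ Real.log T := fun c h1 h2 =>
    (Real.log_le_log h1 h2).trans h7
  set x := 6 * T^2 * M / σ^2 with hx
  have hx0 : 0 < x := by positivity
  have hlx : Real.log x = Real.log 6 + 2 * Real.log T + Real.log M - 2 * Real.log σ := by
    rw [hx, Real.log_div (by positivity) (by positivity), Real.log_mul (by positivity) (by positivity),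
      Real.log_mul (by positivity) (by positivity), Real.log_pow, Real.log_pow]; norm_num
  have c6 := h10 6 (by norm_num) (by norm_num)
  set ρ := ⌈x⌉₊ with hρ
  have hρ1 : 1 ≤ ρ := Nat.one_le_iff_ne_zero.mpr (Nat.ceil_pos.mpr hx0).ne'
  have hρle : (ρ:ℝ) ≤ 2 * max x 1 := by
    have := (Nat.ceil_lt_add_one hx0.le).le
    have h1 := le_max_left x 1
    have h2 := le_max_right x 1
    linarith
  have hr1 : (1:ℝ) ≤ ρ := by exact_mod_cast hρ1
  have c2 := h10 2 (by norm_num) (by norm_num)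
  have hρlog : Real.log ρ ≤ Real.log 2 + Real.log (max x 1) := by
    rw [← Real.log_mul (by norm_num) (by positivity)]
    exact Real.log_le_log (by linarith) hρle
  have hρ2 : ρ^2 ≤ A.card := by
    have : (ρ:ℝ)^2 ≤ M := by
      rw [← Real.log_le_log_iff (by positivity) hM, Real.log_pow]
      push_cast
      rcases max_cases x 1 with ⟨h, _⟩ | ⟨h, _⟩
      · rw [h] at hρlog; linarith
      · rw [h, Real.log_one] at hρlog; linarith
    rw [hMdef] at this
    exact_mod_cast this
  have hb : 6 * T ^ 2 * M ≤ ρ * σ ^ 2 := by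
    rw [← div_le_iff₀ (by positivity)]
    exact Nat.le_ceil x
  have main := stepF1 G D hD ρ hρ1 hρ2 σ hσ hlo hhi hb
  have mlog := Real.log_le_log (by positivity) main
  rw [← hMdef] at mlog
  rw [Real.log_mul (by positivity) (by positivity), Real.log_mul (by positivity) (by positivity),
    Real.log_mul (by positivity) (by positivity), Real.log_mul (by positivity) (by positivity), Real.log_pow] at mlog
  have e1 : Real.log 192 + 3 * Real.log 2 + 3 * Real.log 6 ≤ Real.log T := by
    have := h10 (192 * 2^3 * 6^3) (by norm_num) (by norm_num)
    rw [Real.log_mul (by positivity) (by positivity), Real.log_mul (by positivity) (by positivity), Real.log_pow, Real.log_pow] at this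
    exact_mod_cast this
  have e6 : 0 ≤ Real.log 6 := Real.log_nonneg (by norm_num)
  push_cast at mlog
  rcases max_cases x 1 with ⟨h, _⟩ | ⟨h, _⟩
  · rw [h] at hρlog; left; linarith
  · rw [h, Real.log_one] at hρlog; right; linarith

lemma t2_aux (n τ M ρ T : ℝ) (hM : 0 < M) (hρ : 0 < ρ) (hT : 0 < T) :
    6 * T * (n * τ / M^2 * τ * ρ / (96 * T)) * M^2 / ρ = n * τ^2 / 16 := by
  field_simp; ring

set_option maxHeartbeats 4000000 in
lemma core {A : Finset V4} {m : ℕ} {T : ℝ} (G : Good A m T) (hT7 : 10^7 ≤ T) (hTM : T^10000 ≤ A.card) :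
    ∑ d ∈ Dl A, (rr A d : ℝ)^2 ≤ (A.card : ℝ) ^ (2 + 1 / 3 - 1 / 1392 : ℝ) := by
  classical
  have hT0 : 0 < T := by linarith
  have hM : (0:ℝ) < A.card := lt_of_lt_of_le (by positivity) hTM
  by_contra hc
  push Not at hc
  set M : ℝ := (A.card : ℝ) with hMdef
  clear_value M
  have hL : 10000 * Real.log T ≤ Real.log M := by
    have := Real.log_le_log (by positivity) hTM
    rw [Real.log_pow] at this; exact_mod_cast this
  have h7 : Real.log (10^7) ≤ Real.log T := Real.log_le_log (by norm_num) hT7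
  have hl0 : 0 < Real.log T := Real.log_pos (by linarith)
  have h10 : ∀ c : ℝ, 0 < c → c ≤ 10^7 → Real.log c ≤ Real.log T := fun c h1 h2 =>
    (Real.log_le_log h1 h2).trans h7
  have hMp : 0 < M ^ (2 + 1 / 3 - 1 / 1392 : ℝ) := by positivity
  obtain ⟨τ, hτ1, hNne, hE⟩ := dyadic G (Dl A) (hMp.trans hc)
  set N := (Dl A).filter (fun d => τ ≤ rr A d ∧ (rr A d : ℝ) ≤ 2 * τ) with hN
  have hNsub : N ⊆ Dl A := Finset.filter_subset _ _
  have hlo : ∀ d ∈ N, τ ≤ rr A d := fun d hd => (Finset.mem_filter.mp hd).2.1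
  have hhi : ∀ d ∈ N, (rr A d : ℝ) ≤ 2 * τ := fun d hd => (Finset.mem_filter.mp hd).2.2
  have hτ0 : 0 < τ := by linarith
  have hn0 : (0:ℝ) < N.card := by exact_mod_cast Finset.card_pos.mpr hNne
  clear_value N
  have q1 := Real.log_le_log hMp (hc.le.trans hE)
  rw [Real.log_rpow hM, Real.log_mul (by positivity) (by positivity), Real.log_mul (by positivity) (by positivity),
    Real.log_mul (by positivity) (by positivity), Real.log_pow] at q1
  push_cast at q1
  have c4 := h10 4 (by norm_num) (by norm_num)
  have q2 : Real.log N.card + Real.log τ ≤ 2 * Real.log M := by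
    have h1 : (N.card : ℝ) * τ ≤ M^2 := by
      have h2 : ((∑ d ∈ N, rr A d : ℕ) : ℝ) ≤ ((A.card^2 : ℕ) : ℝ) := Nat.cast_le.mpr (sum_rr_le A N)
      push_cast at h2
      rw [← hMdef] at h2
      refine le_trans ?_ h2
      rw [← nsmul_eq_mul]
      exact Finset.card_nsmul_le_sum _ _ _ hlo
    have := Real.log_le_log (by positivity) h1
    rw [Real.log_mul (by positivity) (by positivity), Real.log_pow] at this
    exact_mod_cast this
  have q3 : Real.log τ ≤ Real.log M := by
    obtain ⟨d, hd⟩ := hNne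
    apply Real.log_le_log hτ0
    exact (hlo d hd).trans (by rw [hMdef]; exact_mod_cast rr_le A d)
  have q4 := F1log G hT7 (hMdef ▸ hTM) N hNsub hNne τ hτ0 hlo hhi (by rw [← hMdef]; linarith)
  rw [← hMdef] at q4
  have q5 : 7 * Real.log τ + Real.log N.card ≤ 8 * Real.log T + 4 * Real.log M := by
    rcases q4 with h | h
    · exact h
    · exfalso; linarith
  clear q4
  -- parameters
  set α := N.card * τ / M^2 with hα
  have hα0 : 0 < α := by positivity
  have la : Real.log α = Real.log N.card + Real.log τ - 2 * Real.log M := by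
    rw [hα, Real.log_div (by positivity) (by positivity), Real.log_mul (by positivity) (by positivity), Real.log_pow]
    norm_num
  set ρ := ⌈M ^ (1/12 : ℝ)⌉₊ with hρ
  have hMq : 0 < M ^ (1/12 : ℝ) := by positivity
  have hM1 : 1 ≤ M := by
    rw [← Real.log_nonneg_iff hM]; linarith
  have hMq1 : 1 ≤ M ^ (1/12 : ℝ) := Real.one_le_rpow hM1 (by norm_num)
  have hρ1 : 1 ≤ ρ := Nat.one_le_iff_ne_zero.mpr (Nat.ceil_pos.mpr hMq).ne'
  have hρ0 : (0:ℝ) < ρ := by exact_mod_cast hρ1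
  have c2 := h10 2 (by norm_num) (by norm_num)
  have r1 : 1/12 * Real.log M ≤ Real.log ρ := by
    rw [← Real.log_rpow hM]
    exact Real.log_le_log hMq (Nat.le_ceil _)
  have r2 : Real.log ρ ≤ Real.log T + 1/12 * Real.log M := by
    have h1 : (ρ:ℝ) ≤ 2 * M ^ (1/12 : ℝ) := by
      have := (Nat.ceil_lt_add_one hMq.le).le
      linarith
    have := Real.log_le_log hρ0 h1
    rw [Real.log_mul (by norm_num) (by positivity), Real.log_rpow hM] at this
    linarith
  have hρ2 : ρ^2 ≤ A.card := by
    have : (ρ:ℝ)^2 ≤ M := by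
      rw [← Real.log_le_log_iff (by positivity) hM, Real.log_pow]
      push_cast; linarith
    rw [hMdef] at this
    exact_mod_cast this
  have hρN : ρ ≤ N.card := by
    have : (ρ:ℝ) ≤ N.card := by
      rw [← Real.log_le_log_iff (by positivity) hn0]
      linarith
    exact_mod_cast this
  clear_value ρ α
  set σ0 := α * τ * ρ / (96 * T) with hσ0
  have hσ0p : 0 < σ0 := by positivity
  have ls : Real.log σ0 = Real.log α + Real.log τ + Real.log ρ - (Real.log 96 + Real.log T) := by
    rw [hσ0, Real.log_div (by positivity) (by positivity), Real.log_mul (by positivity) (by positivity),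
      Real.log_mul (by positivity) (by positivity), Real.log_mul (by positivity) (by positivity)]
  have c96 := h10 96 (by norm_num) (by norm_num)
  clear_value σ0
  set X := ∑ d ∈ (Dl A).filter (fun d => σ0 < rr A d), (rr A d : ℝ)^2 with hX
  have hX0 : 0 ≤ X := Finset.sum_nonneg (fun _ _ => by positivity)
  clear_value X
  have sm := stepMain G N hNsub ρ hρ1 hρ2 hρN τ hτ0 hlo hhi (α/2) σ0 (X+1) (by positivity)
    (by rw [hα, ← hMdef]; apply le_of_eq; field_simp) hσ0p (by linarith) (by rw [← hX]; linarith)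
  rw [← hMdef] at sm
  have t2 : 6 * T * σ0 * M^2 / ρ = N.card * τ^2 / 16 := by
    rw [hσ0, hα]; exact t2_aux _ _ _ _ _ hM hρ0 hT0
  have t1 : 192 * T * ρ^3 * τ * N.card / (α/2) ≤ N.card * τ^2 / 16 := by
    have h1 : 6144 * T * ρ^3 ≤ α * τ := by
      rw [← Real.log_le_log_iff (by positivity) (by positivity), Real.log_mul (by positivity) (by positivity),
        Real.log_mul (by positivity) (by positivity), Real.log_mul (by positivity) (by positivity), Real.log_pow]
      have := h10 6144 (by norm_num) (by norm_num)
      push_cast; linarith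
    rw [div_le_iff₀ (by positivity)]
    have h2 := mul_le_mul_of_nonneg_left h1 (show 0 ≤ τ * N.card / 32 by positivity)
    linarith
  have t3 : N.card * τ^2 / 8 ≤ 192 * T^2 * ρ^2 * (X+1) / (α/2) := by linarith
  rw [le_div_iff₀ (by positivity)] at t3
  have lX := Real.log_le_log (by positivity) t3
  rw [Real.log_mul (by positivity) (by positivity), Real.log_div (by positivity) (by positivity),
    Real.log_mul (by positivity) (by positivity), Real.log_div (by positivity) (by positivity),
    Real.log_mul (by positivity) (by positivity), Real.log_mul (by positivity) (by positivity),
    Real.log_mul (by positivity) (by positivity), Real.log_pow, Real.log_pow, Real.log_pow] at lX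
  have c192 := h10 192 (by norm_num) (by norm_num)
  have c8 := h10 8 (by norm_num) (by norm_num)
  push_cast at lX
  have hX1 : 1 ≤ X := by
    by_contra hx
    push Not at hx
    have : Real.log (X+1) ≤ Real.log 2 := Real.log_le_log (by linarith) (by linarith)
    linarith
  have lX2 : Real.log (X+1) ≤ Real.log T + Real.log X := by
    have : Real.log (X+1) ≤ Real.log (2 * X) := Real.log_le_log (by linarith) (by linarith)
    rw [Real.log_mul (by norm_num) (by positivity)] at this
    linarith
  obtain ⟨σ, hσ1, hDne, hE2⟩ := dyadic G ((Dl A).filter (fun d => σ0 < rr A d)) (by rw [← hX]; linarith)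
  rw [← hX] at hE2
  set D := ((Dl A).filter (fun d => σ0 < rr A d)).filter (fun d => σ ≤ rr A d ∧ (rr A d : ℝ) ≤ 2 * σ) with hD
  have hDsub : D ⊆ Dl A := (Finset.filter_subset _ _).trans (Finset.filter_subset _ _)
  have hlo2 : ∀ d ∈ D, σ ≤ rr A d := fun d hd => (Finset.mem_filter.mp hd).2.1
  have hhi2 : ∀ d ∈ D, (rr A d : ℝ) ≤ 2 * σ := fun d hd => (Finset.mem_filter.mp hd).2.2
  have hgt : ∀ d ∈ D, σ0 < rr A d := fun d hd => (Finset.mem_filter.mp (Finset.mem_filter.mp hd).1).2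
  clear_value D
  have hd0 : (0:ℝ) < D.card := by exact_mod_cast Finset.card_pos.mpr hDne
  have lσ : Real.log σ0 ≤ Real.log T + Real.log σ ∧ Real.log σ ≤ Real.log M := by
    obtain ⟨d, hd⟩ := hDne
    have h1 := hgt d hd
    have h2 := hhi2 d hd
    have h3 := Real.log_le_log hσ0p (h1.le.trans h2)
    rw [Real.log_mul (by norm_num) (by positivity)] at h3
    refine ⟨by linarith, Real.log_le_log (by linarith) ?_⟩
    exact (hlo2 d hd).trans (by rw [hMdef]; exact_mod_cast rr_le A d)
  have s1 := Real.log_le_log (by linarith) hE2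
  rw [Real.log_mul (by positivity) (by positivity), Real.log_mul (by positivity) (by positivity),
    Real.log_mul (by positivity) (by positivity), Real.log_pow] at s1
  push_cast at s1
  have s2 := F1log G hT7 (hMdef ▸ hTM) D hDsub hDne σ (by linarith) hlo2 hhi2 (by rw [← hMdef]; linarith [lσ.1])
  rw [← hMdef] at s2
  obtain ⟨lσ1, lσ2⟩ := lσ
  rcases s2 with h | h <;> linarith

lemma energy_le (A : Finset V4) :
    (addEnergy 2 (A : Set V4) : ℝ) ≤ (A.card : ℝ)^2 + ∑ d ∈ Dl A, (rr A d : ℝ)^2 := by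
  classical
  set R : V4 → Finset V4 := fun d => A.filter (fun x => x - d ∈ A) with hR
  have hrr : ∀ d, rr A d = (R d).card := fun d => rfl
  set B : Finset (Σ _ : V4, V4 × V4) := (insert 0 (Dl A)).sigma (fun d => R d ×ˢ R d) with hB
  have h0 : (0 : V4) ∉ Dl A := by simp [Dl]
  have hBc : B.card = A.card^2 + ∑ d ∈ Dl A, (rr A d)^2 := by
    rw [hB, Finset.card_sigma, Finset.sum_insert h0]
    congr 1
    · rw [Finset.card_product]; simp [hR]; ring
    · apply Finset.sum_congr rfl; intro d _; rw [Finset.card_product, hrr]; ring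
  have hcard : addEnergy 2 (A : Set V4) ≤ B.card := by
    unfold _root_.addEnergy
    rw [← Fintype.card_coe B, ← Nat.card_eq_fintype_card]
    refine Nat.card_le_card_of_injective
      (fun p => (⟨⟨p.1.1 0 - p.1.2 0, (p.1.1 0, p.1.2 1)⟩, ?_⟩ : B)) ?_
    · obtain ⟨p, h1, h2, h3⟩ := p
      simp only [Fin.sum_univ_two] at h3
      simp only [hB, Finset.mem_sigma, Finset.mem_product, hR, Finset.mem_filter, Finset.mem_insert]
      have e1 : p.1 0 - (p.1 0 - p.2 0) = p.2 0 := by abel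
      have e2 : p.2 1 - (p.1 0 - p.2 0) = p.1 1 := by
        have : p.1 1 = p.2 0 + p.2 1 - p.1 0 := by rw [← h3]; abel
        rw [this]; abel
      rw [e1, e2]
      refine ⟨?_, ⟨h1 0, h2 0⟩, ⟨h2 1, h1 1⟩⟩
      by_cases h : p.2 0 = p.1 0
      · left; rw [h, sub_self]
      · right; exact mem_Dl (h1 0) (h2 0) h
    · rintro ⟨p, h1, h2, h3⟩ ⟨p', h1', h2', h3'⟩ h
      simp only [Fin.sum_univ_two] at h3 h3'
      simp only [Subtype.mk.injEq, Sigma.mk.injEq, heq_eq_eq, Prod.mk.injEq] at h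
      obtain ⟨a, b, c⟩ := h
      rw [b] at a
      have d : p.2 0 = p'.2 0 := sub_right_inj.mp a
      rw [b, d, c] at h3
      have e : p.1 1 = p'.1 1 := by
        rw [← h3'] at h3; exact add_left_cancel h3
      apply Subtype.ext
      apply Prod.ext
      · funext i; fin_cases i
        · exact b
        · exact e
      · funext i; fin_cases i
        · exact d
        · exact c
  rw [hBc] at hcard
  exact_mod_cast hcard

lemma energy_triv (A : Finset V4) : ∑ d ∈ Dl A, (rr A d : ℝ)^2 ≤ (A.card : ℝ)^3 := by
  have h1 : ∑ d ∈ Dl A, (rr A d)^2 ≤ A.card^3 := by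
    calc ∑ d ∈ Dl A, (rr A d)^2 ≤ ∑ d ∈ Dl A, A.card * rr A d := by
          apply Finset.sum_le_sum; intro d _; rw [sq]; exact Nat.mul_le_mul_right _ (rr_le A d)
      _ = A.card * ∑ d ∈ Dl A, rr A d := by rw [Finset.mul_sum]
      _ ≤ A.card * A.card^2 := Nat.mul_le_mul_left _ (sum_rr_le A _)
      _ = A.card^3 := by ring
  exact_mod_cast h1

lemma card_sphere {A : Finset V4} {m : ℕ} (hm : 0 < m) (hA : ∀ x ∈ A, ∑ i, x i ^ 2 = (m:ℤ)) :
    A.card ≤ (3 * m)^4 := by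
  classical
  have hsub : A ⊆ Fintype.piFinset (fun _ : Fin 4 => Finset.Icc (-(m:ℤ)) m) := by
    intro x hx
    rw [Fintype.mem_piFinset]
    intro i
    have h1 : x i ^ 2 ≤ (m:ℤ) := by
      rw [← hA x hx]
      exact Finset.single_le_sum (f := fun i => x i ^ 2) (fun _ _ => sq_nonneg _) (Finset.mem_univ i)
    rw [Finset.mem_Icc]
    constructor <;> nlinarith
  refine (Finset.card_le_card hsub).trans ?_
  rw [Fintype.card_piFinset]
  simp only [Int.card_Icc, Finset.prod_const, Finset.card_univ, Fintype.card_fin]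
  apply Nat.pow_le_pow_left
  omega

lemma exists_good (e : ℝ) (he : 0 < e) : ∃ C : ℝ, 10^7 ≤ C ∧ ∀ m : ℕ, 0 < m → ∀ A : Finset V4, A.Nonempty →
    (∀ x ∈ A, ∑ i, x i ^ 2 = (m:ℤ)) → Good A m (C * (m:ℝ)^e) := by
  classical
  obtain ⟨C1, hC1, h1⟩ := divisor_bound e he
  obtain ⟨C2, hC2, h2⟩ := divisor_bound (e/18) (by positivity)
  set K1 := C1 * (9:ℝ)^e with hK1
  set K2 := 10 * (C2 * (2 * 10^8 : ℝ)^(e/18))^3 with hK2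
  set K3 := 8 * (3:ℝ)^e / e + 1 with hK3
  have p1 : 0 < K1 := by positivity
  have p2 : 0 < K2 := by positivity
  have p3 : 0 < K3 := by positivity
  refine ⟨K1 + K2 + K3 + 10^7, by linarith, ?_⟩
  intro m hm A hAne hA
  have hm1 : (1:ℝ) ≤ m := by exact_mod_cast hm
  have hm0 : (0:ℝ) < m := by linarith
  set me := (m:ℝ)^e with hme
  have me1 : 1 ≤ me := Real.one_le_rpow hm1 he.le
  set T := (K1 + K2 + K3 + 10^7) * me with hT
  have T1 : K1 * me ≤ T := by rw [hT]; apply mul_le_mul_of_nonneg_right _ (by linarith); linarith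
  have T2 : K2 * me ≤ T := by rw [hT]; apply mul_le_mul_of_nonneg_right _ (by linarith); linarith
  have T3 : K3 * me ≤ T := by rw [hT]; apply mul_le_mul_of_nonneg_right _ (by linarith); linarith
  have T0 : 1 ≤ T := by
    have : 10^7 * me ≤ T := by rw [hT]; apply mul_le_mul_of_nonneg_right _ (by linarith); linarith
    linarith
  refine ⟨hA, T0, ?_, ?_, ?_⟩
  · intro n hn hn9
    have hn9' : (n:ℝ) ≤ 9 * m := by exact_mod_cast hn9
    refine le_trans (h1 n hn) (le_trans ?_ T1)
    rw [hK1, mul_assoc, hme, ← Real.mul_rpow (by norm_num) hm0.le]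
    gcongr
  · intro d hd d' hd' hne
    have hfl : 1 ≤ ⌊T⌋₊ := Nat.le_floor (by exact_mod_cast T0)
    have key := circle1 m d d' (Finset.mem_erase.mp hd).1 (Finset.mem_erase.mp hd').1 hne
      (Dl_norm hA hd) (Dl_norm hA hd') (A.filter (fun x => FF d x = 0 ∧ FF d' x = 0)) (by
        intro x hx
        obtain ⟨hx, a, b⟩ := Finset.mem_filter.mp hx
        unfold FF at a b
        exact ⟨hA x hx, by linarith, by linarith⟩) ⌊T⌋₊ (by
        intro N hN hNle
        apply Nat.le_floor
        have hb := h2 N hN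
        have hN' : (N:ℝ) ≤ 2 * 10^8 * (m:ℝ)^6 := by exact_mod_cast hNle
        have hb2 : (N.divisors.card : ℝ) ≤ C2 * (2 * 10^8 : ℝ)^(e/18) * ((m:ℝ)^6)^(e/18) := by
          refine hb.trans ?_
          rw [mul_assoc, ← Real.mul_rpow (by norm_num) (by positivity)]
          gcongr
        have hb3 : (((m:ℝ)^6)^(e/18))^3 = me := by
          rw [hme, ← Real.rpow_natCast, ← Real.rpow_natCast, ← Real.rpow_mul hm0.le, ← Real.rpow_mul hm0.le]
          congr 1; push_cast; ring
        push_cast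
        calc 10 * (N.divisors.card : ℝ)^3 ≤ 10 * (C2 * (2 * 10^8 : ℝ)^(e/18) * ((m:ℝ)^6)^(e/18))^3 := by gcongr
          _ = K2 * me := by rw [mul_pow, hb3, hK2]; ring
          _ ≤ T := T2) hfl
    exact le_trans (by exact_mod_cast key) (Nat.floor_le (by linarith))
  · have hM0 : A.card ≠ 0 := (Finset.card_pos.mpr hAne).ne'
    have a1 : (2:ℝ)^(Nat.log 2 A.card) ≤ (3 * m)^4 := by
      exact_mod_cast (Nat.pow_log_le_self 2 hM0).trans (card_sphere hm hA)
    have a2 := Real.log_le_log (by positivity) a1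
    rw [Real.log_pow, Real.log_pow] at a2
    have a3 := Real.log_le_rpow_div (show (0:ℝ) ≤ 3 * m by positivity) he
    rw [Real.mul_rpow (by norm_num) hm0.le, ← hme] at a3
    have a4 := Real.log_two_gt_d9
    push_cast at a2
    have a5 : (0:ℝ) ≤ Nat.log 2 A.card := by positivity
    have a6 : (Nat.log 2 A.card : ℝ) ≤ 8 * ((3:ℝ)^e * me / e) := by nlinarith
    have a7 : K3 * me = 8 * ((3:ℝ)^e * me / e) + me := by rw [hK3]; ring
    linarith

theorem statement_1 (ε : ℝ) (hε : 0 < ε) :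
    ∃ C : ℝ, 0 < C ∧
      ∀ m : ℕ, 0 < m → ∀ A : Set (Fin 4 → ℤ), A.Finite → A.Nonempty → A ⊆ latSphere 4 m →
        (addEnergy 2 A : ℝ) ≤ C * (m : ℝ) ^ ε *
          (A.ncard : ℝ) ^ (2 + 1 / 3 - 1 / 1392 : ℝ) := by
  obtain ⟨C, hC, hG⟩ := exists_good (ε/10000) (by positivity)
  have hC0 : 0 < C := by linarith
  refine ⟨2 * C^10000, by positivity, ?_⟩
  intro m hm A hfin hne hsub
  obtain ⟨B, rfl⟩ := hfin.exists_finset_coe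
  rw [Set.ncard_coe_finset]
  have hB : B.Nonempty := by exact_mod_cast hne
  have G := hG m hm B hB (fun x hx => hsub hx)
  have hm1 : (1:ℝ) ≤ m := by exact_mod_cast hm
  have hm0 : (0:ℝ) < m := by linarith
  have hM1 : (1:ℝ) ≤ B.card := by exact_mod_cast Finset.card_pos.mpr hB
  have hme : 1 ≤ (m:ℝ)^(ε/10000) := Real.one_le_rpow hm1 (by positivity)
  set T := C * (m:ℝ)^(ε/10000) with hT
  have hT7 : 10^7 ≤ T := hC.trans (le_mul_of_one_le_right hC0.le hme)
  have hTp : T^10000 = C^10000 * (m:ℝ)^ε := by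
    rw [hT, mul_pow, ← Real.rpow_natCast ((m:ℝ)^(ε/10000)), ← Real.rpow_mul hm0.le]
    congr 2; push_cast; ring
  have hT1 : 1 ≤ T^10000 := one_le_pow₀ (by linarith)
  have e1 := energy_le B
  have hP : (B.card:ℝ)^2 ≤ (B.card : ℝ) ^ (2 + 1 / 3 - 1 / 1392 : ℝ) := by
    rw [← Real.rpow_natCast]
    apply Real.rpow_le_rpow_of_exponent_le hM1; norm_num
  have goal' : (addEnergy 2 (B : Set V4) : ℝ) ≤ 2 * T^10000 * (B.card : ℝ) ^ (2 + 1 / 3 - 1 / 1392 : ℝ) := by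
    rcases le_total (T^10000) (B.card : ℝ) with h | h
    · have := core G hT7 h
      have h3 : (B.card : ℝ) ^ (2 + 1 / 3 - 1 / 1392 : ℝ) ≤ T^10000 * (B.card : ℝ) ^ (2 + 1 / 3 - 1 / 1392 : ℝ) :=
        le_mul_of_one_le_left (by positivity) hT1
      linarith
    · have h1 := energy_triv B
      have h2 : (B.card:ℝ)^3 ≤ T^10000 * (B.card : ℝ) ^ (2 + 1 / 3 - 1 / 1392 : ℝ) := by
        calc (B.card:ℝ)^3 = B.card * (B.card:ℝ)^2 := by ring
          _ ≤ _ := mul_le_mul h hP (by positivity) (by positivity)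
      have h3 : (B.card : ℝ) ^ (2 + 1 / 3 - 1 / 1392 : ℝ) ≤ T^10000 * (B.card : ℝ) ^ (2 + 1 / 3 - 1 / 1392 : ℝ) :=
        le_mul_of_one_le_left (by positivity) hT1
      linarith
  rw [hTp] at goal'
  calc _ ≤ _ := goal'
    _ = _ := by ring
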